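/- arXiv:2007.12166 — 10 statements merged into one kernel-verified Lean document; each statement's English description precedes it below -/
import Mathlib

section
/- Let v : [0,1) → ℝ be defined by v(r) = 2r/(1 − r²). Then v(0) = 0 and for every r ∈ (0,1), v is differentiable at r with v'(r) = v(r)(1 + v(r)²)/(v(r) − r). In other words, v is an explicit solution on [0,1) of the ODE for rotationally symmetric graphical Q₁-translators in ℝ³. -/
/-- The function `v r = 2r/(1 - r²)` is an explicit solution on `[0,1)` of the ODE
`v' = v(1+v²)/(v - r)` (the ODE for rotationally symmetric graphical `Q₁`-translators
in `ℝ³`, i.e. the case `n = 2` of `v' = v(1+v²)/(v - (n-1)r)`), with `v 0 = 0`. -/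
theorem q1_translator_slope_explicit_solution :
    (fun r : ℝ => 2 * r / (1 - r ^ 2)) 0 = 0 ∧
    ∀ r ∈ Set.Ioo (0 : ℝ) 1,
      HasDerivAt (fun r : ℝ => 2 * r / (1 - r ^ 2))
        ((2 * r / (1 - r ^ 2)) * (1 + (2 * r / (1 - r ^ 2)) ^ 2) /
          ((2 * r / (1 - r ^ 2)) - r)) r := by
  refine ⟨by simp, fun r ⟨hr0, hr1⟩ => ?_⟩
  have hden : 1 - r ^ 2 ≠ 0 := by nlinarith
  have hnum : 1 + r ^ 2 ≠ 0 := by positivity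
  have hsub : 2 * r / (1 - r ^ 2) - r = r * (1 + r ^ 2) / (1 - r ^ 2) := by
    field_simp
    ring
  have hderiv := ((hasDerivAt_id' r).const_mul 2).fun_div
    ((hasDerivAt_pow 2 r).const_sub 1) hden
  refine hderiv.congr_deriv ?_
  rw [hsub]
  have hr : r ≠ 0 := hr0.ne'
  field_simp
  push_cast
  ring
end

section
/- Let u : [0,1) → ℝ be defined by u(r) = −ln(1 − r²). Then u(0) = 0, u'(0) = 0, and for every r ∈ (0,1): u''(r) = u'(r)(1 + u'(r)²)/(u'(r) − r), u'(r) > 0 and u''(r) > 0. Moreover u(r) → ∞ as r → 1⁻. (Hence the rotationally symmetric graph z = −ln(1−x²−y²) over the open unit disc is a complete, non-entire, strictly convex rotationally symmetric Q₁-translator graph in ℝ³.) -/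
open Filter

theorem hasDerivAt_neg_log_one_sub_sq {r : ℝ} (hr : 1 - r ^ 2 ≠ 0) :
    HasDerivAt (fun r : ℝ => -Real.log (1 - r ^ 2)) (2 * r / (1 - r ^ 2)) r := by
  have h := (((hasDerivAt_pow 2 r).const_sub 1).log hr).neg
  exact h.congr_deriv (by norm_num [neg_div])

theorem deriv_deriv_neg_log_one_sub_sq {r : ℝ} (hr : 1 - r ^ 2 ≠ 0) :
    deriv (deriv (fun r : ℝ => -Real.log (1 - r ^ 2))) r =
      2 * (1 + r ^ 2) / (1 - r ^ 2) ^ 2 := by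
  have hne : ∀ᶠ x in nhds r, 1 - x ^ 2 ≠ 0 :=
    (show ContinuousAt (fun x : ℝ => 1 - x ^ 2) r by fun_prop).eventually_ne hr
  have heq : deriv (fun r : ℝ => -Real.log (1 - r ^ 2)) =ᶠ[nhds r]
      fun x => 2 * x / (1 - x ^ 2) :=
    hne.mono fun x hx => (hasDerivAt_neg_log_one_sub_sq hx).deriv
  rw [heq.deriv_eq]
  have h := ((hasDerivAt_id r).const_mul 2).div ((hasDerivAt_pow 2 r).const_sub 1) hr
  refine HasDerivAt.deriv (f := fun x : ℝ => 2 * x / (1 - x ^ 2)) (h.congr_deriv ?_)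
  congr 1
  simp only [id, Nat.cast_ofNat]
  ring

theorem tendsto_neg_log_one_sub_sq :
    Tendsto (fun r : ℝ => -Real.log (1 - r ^ 2)) (nhdsWithin 1 (Set.Iio 1)) atTop := by
  refine tendsto_neg_atBot_atTop.comp (Real.tendsto_log_nhdsNE_zero.comp
    (tendsto_nhdsWithin_iff.2 ⟨?_, ?_⟩))
  · have h : ContinuousAt (fun x : ℝ => 1 - x ^ 2) 1 := by fun_prop
    simpa [ContinuousAt] using h.mono_left nhdsWithin_le_nhds
  · filter_upwards [Ioo_mem_nhdsLT (show (0 : ℝ) < 1 by norm_num)] with x hx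
    exact ne_of_gt (by nlinarith [hx.1, hx.2] : (0 : ℝ) < 1 - x ^ 2)

/-- The function `u r = -ln(1 - r²)` on `[0,1)` satisfies `u 0 = 0`, `u' 0 = 0`,
solves the ODE `u'' = u'(1+u'²)/(u' - r)` for rotationally symmetric graphical
`Q₁`-translators in `ℝ³` on `(0,1)`, is strictly convex there (`u' > 0`, `u'' > 0`),
and blows up as `r → 1⁻`.  Hence the rotationally symmetric graph
`z = -ln(1-x²-y²)` over the open unit disc is a complete, non-entire, strictly
convex rotationally symmetric `Q₁`-translator graph in `ℝ³`. -/
theorem q1_translator_profile_explicit_solution :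
    (fun r : ℝ => -Real.log (1 - r ^ 2)) 0 = 0 ∧
    deriv (fun r : ℝ => -Real.log (1 - r ^ 2)) 0 = 0 ∧
    (∀ r ∈ Set.Ioo (0 : ℝ) 1,
      deriv (deriv (fun r : ℝ => -Real.log (1 - r ^ 2))) r =
        deriv (fun r : ℝ => -Real.log (1 - r ^ 2)) r *
          (1 + (deriv (fun r : ℝ => -Real.log (1 - r ^ 2)) r) ^ 2) /
          (deriv (fun r : ℝ => -Real.log (1 - r ^ 2)) r - r) ∧
      0 < deriv (fun r : ℝ => -Real.log (1 - r ^ 2)) r ∧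
      0 < deriv (deriv (fun r : ℝ => -Real.log (1 - r ^ 2))) r) ∧
    Tendsto (fun r : ℝ => -Real.log (1 - r ^ 2)) (nhdsWithin 1 (Set.Iio 1)) atTop := by
  refine ⟨by simp, ?_, fun r hr => ?_, tendsto_neg_log_one_sub_sq⟩
  · rw [(hasDerivAt_neg_log_one_sub_sq (by norm_num)).deriv]
    norm_num
  · have hr0 : 0 < r := hr.1
    have hpos : 0 < 1 - r ^ 2 := by nlinarith [hr.1, hr.2]
    rw [deriv_deriv_neg_log_one_sub_sq hpos.ne', (hasDerivAt_neg_log_one_sub_sq hpos.ne').deriv]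
    refine ⟨?_, by positivity, by positivity⟩
    have hsub : 2 * r / (1 - r ^ 2) - r = r * (1 + r ^ 2) / (1 - r ^ 2) := by
      field_simp
      ring
    rw [hsub]
    field_simp
    ring
end

section
/- Let n ≥ 2 be an integer and R > 0. Suppose v : [0,R) → ℝ is continuously differentiable with v(0) = 0, v(r) > (n−1)r for all r ∈ (0,R), and v'(r) = v(r)(1 + v(r)²)/(v(r) − (n−1)r) for all r ∈ (0,R). Then v(r) ≥ n r for all r ∈ [0,R), and consequently v'(r) > 0 for all r ∈ (0,R), i.e. v is strictly increasing on (0,R). (This follows by comparison with the strict subsolution w₀(r) = n r, which satisfies w₀'(r) = n < n(1 + n²r²) = w₀(1 + w₀²)/(w₀ − (n−1)r) for r > 0.) -/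
/-- A function continuous on `[0, a]` with `g 0 = 0`, whose derivative is positive wherever `g` is
negative, is nonnegative at `a`. -/
theorem nonneg_of_deriv_pos_of_neg {g g' : ℝ → ℝ} {a : ℝ} (ha : 0 ≤ a)
    (hc : ContinuousOn g (Set.Icc 0 a)) (h0 : g 0 = 0)
    (hd : ∀ r ∈ Set.Ioc 0 a, HasDerivAt g (g' r) r)
    (hpos : ∀ r ∈ Set.Ioc 0 a, g r < 0 → 0 < g' r) : 0 ≤ g a := by
  by_contra! hneg
  obtain ⟨c, hcm, hmin⟩ :=
    isCompact_Icc.exists_isMinOn (Set.nonempty_Icc.2 ha) hc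
  have hgc : g c < 0 := (hmin (Set.right_mem_Icc.2 ha)).trans_lt hneg
  have hc0 : 0 < c := by
    refine hcm.1.lt_of_ne ?_
    rintro rfl
    exact hgc.ne h0
  have hcm' : c ∈ Set.Ioc 0 a := ⟨hc0, hcm.2⟩
  have hslope := (hasDerivAt_iff_tendsto_slope.1 (hd c hcm')).eventually
    (lt_mem_nhds (hpos c hcm' hgc))
  have hleft := hslope.filter_mono (nhdsLT_le_nhdsNE c)
  obtain ⟨x, hx, hxm⟩ := (hleft.and (Ioo_mem_nhdsLT hc0)).exists
  rw [slope_def_field] at hx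
  have hle : g c ≤ g x := hmin ⟨hxm.1.le, hxm.2.le.trans hcm.2⟩
  exact hx.not_ge (div_nonpos_of_nonneg_of_nonpos (sub_nonneg.2 hle) (sub_nonpos.2 hxm.2.le))

/-- Comparison with the strict subsolution `w₀ r = n r` of the ODE
`v' = v(1+v²)/(v - (n-1)r)` for rotationally symmetric graphical
`Q_{n-1}`-translators in `ℝ^{n+1}`: any `C¹` solution `v` on `[0,R)` with
`v 0 = 0` and `v r > (n-1) r` satisfies `v r ≥ n r` on `[0,R)`; consequently
`v' > 0` on `(0,R)`, i.e. `v` is strictly increasing on `(0,R)`. -/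
theorem q_translator_slope_increasing (n : ℕ) (hn : 2 ≤ n) (R : ℝ) (hR : 0 < R)
    (v : ℝ → ℝ)
    (hreg : ContDiffOn ℝ 1 v (Set.Ico 0 R))
    (h0 : v 0 = 0)
    (hden : ∀ r ∈ Set.Ioo (0 : ℝ) R, ((n : ℝ) - 1) * r < v r)
    (hode : ∀ r ∈ Set.Ioo (0 : ℝ) R,
      HasDerivAt v (v r * (1 + v r ^ 2) / (v r - ((n : ℝ) - 1) * r)) r) :
    (∀ r ∈ Set.Ico (0 : ℝ) R, (n : ℝ) * r ≤ v r) ∧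
    (∀ r ∈ Set.Ioo (0 : ℝ) R, 0 < v r * (1 + v r ^ 2) / (v r - ((n : ℝ) - 1) * r)) ∧
    StrictMonoOn v (Set.Ioo 0 R) := by
  have hn' : (2 : ℝ) ≤ n := by exact_mod_cast hn
  have hvpos : ∀ r ∈ Set.Ioo (0 : ℝ) R, 0 < v r := fun r hr =>
    (mul_pos (by linarith) hr.1).trans (hden r hr)
  have hderiv : ∀ r ∈ Set.Ioo (0 : ℝ) R,
      0 < v r * (1 + v r ^ 2) / (v r - ((n : ℝ) - 1) * r) := fun r hr =>
    div_pos (mul_pos (hvpos r hr) (by positivity)) (sub_pos.2 (hden r hr))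
  refine ⟨fun a ha => ?_, hderiv, ?_⟩
  · have hsub : Set.Icc 0 a ⊆ Set.Ico 0 R := fun r hr => ⟨hr.1, hr.2.trans_lt ha.2⟩
    refine sub_nonneg.1 (nonneg_of_deriv_pos_of_neg (g := fun r => v r - n * r)
      (g' := fun r => v r * (1 + v r ^ 2) / (v r - ((n : ℝ) - 1) * r) - n * 1) ha.1
      ((hreg.continuousOn.mono hsub).sub (by fun_prop)) (by simp [h0]) ?_ ?_)
    · intro r hr
      exact (hode r ⟨hr.1, hr.2.trans_lt ha.2⟩).sub ((hasDerivAt_id r).const_mul (n : ℝ))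
    · intro r hr hneg
      have hrR : r ∈ Set.Ioo 0 R := ⟨hr.1, hr.2.trans_lt ha.2⟩
      have hv := hvpos r hrR
      have hcube : 0 < v r * v r ^ 2 := by positivity
      rw [sub_pos, lt_div_iff₀ (sub_pos.2 (hden r hrR))]
      nlinarith [mul_pos (show (0 : ℝ) < n - 1 by linarith) (sub_pos.2 (sub_neg.1 hneg))]
  · refine strictMonoOn_of_deriv_pos (convex_Ioo 0 R)
      (fun r hr => (hode r hr).continuousAt.continuousWithinAt) fun r hr => ?_
    rw [interior_Ioo] at hr
    rw [(hode r hr).deriv]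
    exact hderiv r hr
end

section
/- Let n ≥ 2 be an integer and let w₁(r) = n r/√(1 − n²r²) on [0, 1/n). Then for every r ∈ (0, 1/n), w₁'(r) ≥ w₁(r)(1 + w₁(r)²)/(w₁(r) − (n−1)r); that is, w₁ is a supersolution of the first-order ODE for rotationally symmetric graphical Q_{n−1}-translators on (0, 1/n). -/
/-- The derivative of `t ↦ a t / √(1 - a² t²)` is `a / √(1 - a² r²)³`. -/
theorem hasDerivAt_mul_div_sqrt_one_sub_sq {a r : ℝ} (h : 0 < 1 - a ^ 2 * r ^ 2) :
    HasDerivAt (fun t : ℝ => a * t / Real.sqrt (1 - a ^ 2 * t ^ 2))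
      (a / Real.sqrt (1 - a ^ 2 * r ^ 2) ^ 3) r := by
  have hs : 0 < Real.sqrt (1 - a ^ 2 * r ^ 2) := Real.sqrt_pos.mpr h
  have hsq := Real.sq_sqrt h.le
  have hden := ((((hasDerivAt_id r).pow 2).const_mul (a ^ 2)).const_sub 1).sqrt h.ne'
  refine (((hasDerivAt_id r).const_mul a).div hden hs.ne').congr_deriv ?_
  simp only [Pi.pow_apply, id_eq]
  set s := Real.sqrt (1 - a ^ 2 * r ^ 2)
  field_simp
  push_cast
  linear_combination 2 * a * hsq

/-- The function `w₁ r = n r / √(1 - n² r²)` is a supersolution on `(0, 1/n)` of the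
first-order ODE `v' = v(1+v²)/(v - (n-1)r)` for rotationally symmetric graphical
`Q_{n-1}`-translators in `ℝ^{n+1}`. -/
theorem q_translator_supersolution (n : ℕ) (hn : 2 ≤ n) :
    ∀ r ∈ Set.Ioo (0 : ℝ) (1 / n),
      deriv (fun t : ℝ => (n : ℝ) * t / Real.sqrt (1 - (n : ℝ) ^ 2 * t ^ 2)) r ≥
        ((n : ℝ) * r / Real.sqrt (1 - (n : ℝ) ^ 2 * r ^ 2)) *
          (1 + ((n : ℝ) * r / Real.sqrt (1 - (n : ℝ) ^ 2 * r ^ 2)) ^ 2) /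
          (((n : ℝ) * r / Real.sqrt (1 - (n : ℝ) ^ 2 * r ^ 2)) - ((n : ℝ) - 1) * r) := by
  rintro r ⟨hr, hrn⟩
  have hn0 : (0 : ℝ) < n := by positivity
  have hnr : (n : ℝ) * r < 1 := by rwa [lt_div_iff₀ hn0, mul_comm] at hrn
  have hpos : 0 < 1 - (n : ℝ) ^ 2 * r ^ 2 := by nlinarith [mul_pos hn0 hr]
  rw [(hasDerivAt_mul_div_sqrt_one_sub_sq hpos).deriv]
  have hs : 0 < Real.sqrt (1 - (n : ℝ) ^ 2 * r ^ 2) := Real.sqrt_pos.mpr hpos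
  have hsq := Real.sq_sqrt hpos.le
  have hs1 : Real.sqrt (1 - (n : ℝ) ^ 2 * r ^ 2) ≤ 1 :=
    Real.sqrt_le_one.mpr (sub_le_self _ (by positivity))
  set s := Real.sqrt (1 - (n : ℝ) ^ 2 * r ^ 2)
  have hw : 1 + ((n : ℝ) * r / s) ^ 2 = 1 / s ^ 2 := by
    field_simp
    linear_combination hsq
  have hden : r ≤ (n : ℝ) * r / s - ((n : ℝ) - 1) * r := by
    have : (n : ℝ) * r ≤ n * r / s := le_div_self (by positivity) hs hs1
    linarith
  rw [hw, ge_iff_le, div_le_iff₀ (hr.trans_le hden)]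
  calc (n : ℝ) * r / s * (1 / s ^ 2) = n / s ^ 3 * r := by field_simp
    _ ≤ n / s ^ 3 * ((n : ℝ) * r / s - ((n : ℝ) - 1) * r) := by gcongr
end

section
/- Let n ≥ 2 be an integer and let w₂(r) = −ln(1 − n r) on [0, 1/n). Then for every r ∈ (0, 1/n), w₂''(r) ≤ w₂'(r)(1 + w₂'(r)²)/(w₂'(r) − (n−1)r); that is, w₂ is a subsolution of the second-order ODE for rotationally symmetric graphical Q_{n−1}-translators on (0, 1/n). -/
/-- The derivative of `t ↦ -log (1 - a t)` away from its singularity. -/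
lemma hasDerivAt_neg_log_one_sub_mul (a t : ℝ) (ht : 1 - a * t ≠ 0) :
    HasDerivAt (fun t : ℝ => -Real.log (1 - a * t)) (a / (1 - a * t)) t := by
  have h := ((((hasDerivAt_id t).const_mul a).const_sub 1).log ht).neg
  refine h.congr_deriv ?_
  simp [neg_div]

/-- The second derivative of `t ↦ -log (1 - a t)` is the square of the first. -/
lemma deriv_deriv_neg_log_one_sub_mul (a t : ℝ) (ht : 1 - a * t ≠ 0) :
    deriv (deriv (fun t : ℝ => -Real.log (1 - a * t))) t = (a / (1 - a * t)) ^ 2 := by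
  have hev : deriv (fun t : ℝ => -Real.log (1 - a * t)) =ᶠ[nhds t]
      fun t => a / (1 - a * t) := by
    have hc : ContinuousAt (fun t : ℝ => 1 - a * t) t := by fun_prop
    filter_upwards [hc.eventually_ne ht] with s hs
    exact (hasDerivAt_neg_log_one_sub_mul a s hs).deriv
  rw [hev.deriv_eq]
  have h := (hasDerivAt_const t a).div (((hasDerivAt_id t).const_mul a).const_sub 1) ht
  refine h.deriv.trans ?_
  simp only [id]
  field_simp
  ring

/-- The function `w₂ r = -ln(1 - n r)` is a subsolution on `(0, 1/n)` of the
second-order ODE `u'' = u'(1+u'²)/(u' - (n-1)r)` for rotationally symmetric graphical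
`Q_{n-1}`-translators in `ℝ^{n+1}`. -/
theorem q_translator_subsolution (n : ℕ) (hn : 2 ≤ n) :
    ∀ r ∈ Set.Ioo (0 : ℝ) (1 / n),
      deriv (deriv (fun t : ℝ => -Real.log (1 - (n : ℝ) * t))) r ≤
        deriv (fun t : ℝ => -Real.log (1 - (n : ℝ) * t)) r *
          (1 + (deriv (fun t : ℝ => -Real.log (1 - (n : ℝ) * t)) r) ^ 2) /
          (deriv (fun t : ℝ => -Real.log (1 - (n : ℝ) * t)) r - ((n : ℝ) - 1) * r) := by
  rintro r ⟨hr0, hr1⟩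
  have hn2 : (2 : ℝ) ≤ n := by exact_mod_cast hn
  have hnr : (n : ℝ) * r < 1 := by
    rwa [lt_div_iff₀ (by linarith), mul_comm] at hr1
  have hpos : 0 < 1 - (n : ℝ) * r := by linarith
  have hnr0 : 0 < (n : ℝ) * r := by positivity
  rw [deriv_deriv_neg_log_one_sub_mul _ _ hpos.ne',
    (hasDerivAt_neg_log_one_sub_mul _ _ hpos.ne').deriv]
  have hp : (n : ℝ) ≤ n / (1 - n * r) := by
    rw [le_div_iff₀ hpos]
    nlinarith
  generalize (n : ℝ) / (1 - n * r) = p at hp ⊢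
  have hp0 : 0 < p := by linarith
  have hq : 0 ≤ ((n : ℝ) - 1) * r := mul_nonneg (by linarith) hr0.le
  rw [le_div_iff₀ (by linarith)]
  nlinarith [mul_nonneg (sq_nonneg p) hq]
end

section
/- Let n ≥ 2 be an integer. Then for every r ∈ [0, 1/n], one has n ≤ ((1 − n r)² + n²)/(n − (n−1)r + n(n−1)r²). (The denominator n − (n−1)r + n(n−1)r² is positive on this interval, and the inequality is equivalent to the subsolution inequality for w₂(r) = −ln(1 − n r).) -/
/-- The elementary inequality `n ≤ ((1 - n r)² + n²)/(n - (n-1)r + n(n-1)r²)` for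
`r ∈ [0, 1/n]`, which is the key computation showing that `w₂ r = -ln(1 - n r)` is a
subsolution of the ODE `u'' = u'(1+u'²)/(u' - (n-1)r)` for rotationally symmetric
graphical `Q_{n-1}`-translators in `ℝ^{n+1}`. -/
theorem q_translator_subsolution_key_inequality (n : ℕ) (hn : 2 ≤ n) :
    ∀ r ∈ Set.Icc (0 : ℝ) (1 / n),
      (n : ℝ) ≤ ((1 - (n : ℝ) * r) ^ 2 + (n : ℝ) ^ 2) /
        ((n : ℝ) - ((n : ℝ) - 1) * r + (n : ℝ) * ((n : ℝ) - 1) * r ^ 2) := by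
  rintro r ⟨h0, h1⟩
  have hn' : (2 : ℝ) ≤ n := by exact_mod_cast hn
  have hs : (n : ℝ) * r ≤ 1 := by
    rwa [le_div_iff₀ (by linarith), mul_comm] at h1
  have hden : 0 < (n : ℝ) - ((n : ℝ) - 1) * r + (n : ℝ) * ((n : ℝ) - 1) * r ^ 2 := by
    have hsq : 0 ≤ (n : ℝ) * ((n : ℝ) - 1) * r ^ 2 :=
      mul_nonneg (mul_nonneg (by linarith) (by linarith)) (sq_nonneg r)
    linarith
  rw [le_div_iff₀ hden]
  have hmul : 0 ≤ ((n : ℝ) - 1) * (n * r) * (1 - n * r) :=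
    mul_nonneg (mul_nonneg (by linarith) (mul_nonneg (by linarith) h0)) (by linarith)
  linarith [sq_nonneg (1 - (n : ℝ) * r)]
end

section
/- Let n ≥ 1 be an integer. Then for every r ∈ [0, n⁻¹ arccos(√(n/(n+1)))], one has tan(n r) ≤ (n+1) r; equivalently, the function r ↦ (n+1)r − tan(n r) is non-negative on [0, n⁻¹ arccos(√(n/(n+1)))]. -/
/-- On `[0, arccos c]` the derivative `1 / cos²` of the tangent is at most `1 / c²`, so the tangent
lies below the line of that slope through the origin. -/
theorem Real.tan_le_div_sq_mul_of_le_arccos {c x : ℝ} (hc : 0 < c) (hc1 : c ≤ 1) (hx : 0 ≤ x)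
    (hxc : x ≤ Real.arccos c) : Real.tan x ≤ 1 / c ^ 2 * x := by
  have hcos : ∀ y ∈ Set.Icc 0 (Real.arccos c), c ≤ Real.cos y := fun y hy => by
    simpa [Real.cos_arccos (by linarith) hc1] using
      Real.cos_le_cos_of_nonneg_of_le_pi hy.1 (Real.arccos_le_pi c) hy.2
  have hderiv : ∀ y ∈ Set.Icc 0 (Real.arccos c), HasDerivAt Real.tan (1 / Real.cos y ^ 2) y :=
    fun y hy => Real.hasDerivAt_tan (hc.trans_le (hcos y hy)).ne'
  have h := (convex_Icc 0 (Real.arccos c)).image_sub_le_mul_sub_of_deriv_le (C := 1 / c ^ 2)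
    (fun y hy => (hderiv y hy).continuousAt.continuousWithinAt)
    (fun y hy => (hderiv y (interior_subset hy)).differentiableAt.differentiableWithinAt)
    (fun y hy => by
      rw [(hderiv y (interior_subset hy)).deriv]
      have := hcos y (interior_subset hy)
      gcongr)
    0 ⟨le_rfl, Real.arccos_nonneg c⟩ x ⟨hx, hxc⟩ hx
  simpa using h

/-- For every integer `n ≥ 1` and `r ∈ [0, n⁻¹ arccos(√(n/(n+1)))]` one has
`tan(n r) ≤ (n+1) r`; i.e. `r ↦ (n+1)r - tan(n r)` is non-negative on this interval. -/
theorem tan_le_on_arccos_interval (n : ℕ) (hn : 1 ≤ n) :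
    ∀ r ∈ Set.Icc (0 : ℝ) ((n : ℝ)⁻¹ * Real.arccos (Real.sqrt ((n : ℝ) / ((n : ℝ) + 1)))),
      Real.tan ((n : ℝ) * r) ≤ ((n : ℝ) + 1) * r := by
  rintro r ⟨hr, hr'⟩
  have hn0 : (0 : ℝ) < n := by exact_mod_cast hn
  have hle : Real.sqrt ((n : ℝ) / (n + 1)) ≤ 1 :=
    Real.sqrt_le_one.mpr ((div_le_one (by positivity)).mpr (by linarith))
  have h := Real.tan_le_div_sq_mul_of_le_arccos (by positivity) hle (mul_nonneg hn0.le hr)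
    ((le_inv_mul_iff₀ hn0).mp hr')
  rw [Real.sq_sqrt (by positivity)] at h
  refine h.trans_eq ?_
  field_simp
end

section
/- Let n ≥ 2 be an integer, let u be twice differentiable on an open interval of positive reals, and for r in that interval define λ(r) ∈ ℝⁿ by λ_i(r) = u'(r)/(r√(1 + u'(r)²)) for i = 1, …, n−1 and λ_n(r) = u''(r)/(1 + u'(r)²)^{3/2}. Then for every l with 1 ≤ l ≤ n and every r in the interval, the l-th elementary symmetric polynomial of λ(r) satisfies e_l(λ(r)) = [C(n−1, l−1)/(l · r^{n−1})] · d/dr( r^{n−l} · φ(u'(r))^l ), where φ(x) = x/√(1+x²) and C(n−1, l−1) is the binomial coefficient. -/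
/-- The `l`-th elementary symmetric polynomial of a vector `lam : Fin n → ℝ`. -/
noncomputable def esymmVec (n l : ℕ) (lam : Fin n → ℝ) : ℝ :=
  ∑ s ∈ Finset.powersetCard l (Finset.univ : Finset (Fin n)),
    ∏ i ∈ s, lam i

/-- The elementary symmetric sum over `insert x s` of a function constant on `s`. -/
theorem sum_powersetCard_succ_insert_prod_of_const {ι R : Type*} [DecidableEq ι]
    [CommSemiring R] {s : Finset ι} {x : ι} (hx : x ∉ s) {f : ι → R} {p : R}
    (hf : ∀ i ∈ s, f i = p) (k : ℕ) :
    ∑ t ∈ Finset.powersetCard (k + 1) (insert x s), ∏ i ∈ t, f i =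
      (s.card.choose (k + 1) : R) * p ^ (k + 1) + (s.card.choose k : R) * (f x * p ^ k) := by
  have hprod : ∀ j, ∀ t ∈ Finset.powersetCard j s, ∏ i ∈ t, f i = p ^ j := by
    intro j t ht
    obtain ⟨hts, hcard⟩ := Finset.mem_powersetCard.mp ht
    rw [Finset.prod_congr rfl fun i hi => hf i (hts hi), Finset.prod_const, hcard]
  have hnot : ∀ j, ∀ t ∈ Finset.powersetCard j s, x ∉ t := fun j t ht hxt =>
    hx ((Finset.mem_powersetCard.mp ht).1 hxt)
  rw [Finset.powersetCard_succ_insert hx, Finset.sum_union, Finset.sum_image]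
  · congr 1
    · rw [Finset.sum_congr rfl (hprod _), Finset.sum_const, Finset.card_powersetCard,
        nsmul_eq_mul]
    · rw [Finset.sum_congr rfl fun t ht => by
        rw [Finset.prod_insert (hnot _ t ht), hprod _ t ht], Finset.sum_const,
        Finset.card_powersetCard, nsmul_eq_mul]
  · intro t ht t' ht' h
    rw [← Finset.erase_insert (hnot _ t ht), ← Finset.erase_insert (hnot _ t' ht')]
    exact congrArg (fun v => v.erase x) h
  · rw [Finset.disjoint_left]
    intro t ht ht'
    obtain ⟨v, -, rfl⟩ := Finset.mem_image.mp ht'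
    exact hnot _ _ ht (Finset.mem_insert_self x v)

/-- The derivative of `φ ∘ v`, where `φ(x) = x/√(1+x²)`. -/
theorem HasDerivAt.div_sqrt_one_add_sq {v : ℝ → ℝ} {v' r : ℝ} (hv : HasDerivAt v v' r) :
    HasDerivAt (fun t => v t / Real.sqrt (1 + v t ^ 2))
      (v' / Real.sqrt (1 + v r ^ 2) ^ 3) r := by
  have hpos : 0 < 1 + v r ^ 2 := by positivity
  have hs : 0 < Real.sqrt (1 + v r ^ 2) := Real.sqrt_pos.mpr hpos
  have hsq : Real.sqrt (1 + v r ^ 2) ^ 2 = 1 + v r ^ 2 := Real.sq_sqrt hpos.le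
  have h := hv.fun_div (((hv.fun_pow 2).const_add 1).sqrt hpos.ne') hs.ne'
  refine h.congr_deriv ?_
  field_simp
  simp only [Nat.cast_ofNat]
  rw [hsq]
  ring

/-- For a rotationally symmetric graph in `ℝ^{n+1}` with profile `u`, whose principal
curvatures at radius `r > 0` are `λ₁ = ⋯ = λ_{n-1} = u'/(r√(1+u'²))` and
`λ_n = u''/(1+u'²)^{3/2}`, the `l`-th elementary symmetric polynomial of the principal
curvatures equals `(C(n-1,l-1)/(l rⁿ⁻¹)) (d/dr)(r^{n-l} φ(u')ˡ)` where
`φ(x) = x/√(1+x²)`. -/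
theorem esymm_principal_curvatures_rotationally_symmetric
    (n : ℕ) (hn : 2 ≤ n) (a b : ℝ) (ha : 0 ≤ a)
    (u u' u'' : ℝ → ℝ)
    (hu : ∀ r ∈ Set.Ioo a b, HasDerivAt u (u' r) r)
    (hu' : ∀ r ∈ Set.Ioo a b, HasDerivAt u' (u'' r) r)
    (l : ℕ) (hl1 : 1 ≤ l) (hln : l ≤ n)
    (r : ℝ) (hr : r ∈ Set.Ioo a b) :
    esymmVec n l (fun i =>
        if (i : ℕ) < n - 1 then u' r / (r * Real.sqrt (1 + u' r ^ 2))
        else u'' r / (Real.sqrt (1 + u' r ^ 2)) ^ 3) =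
      ((n - 1).choose (l - 1) : ℝ) / ((l : ℝ) * r ^ (n - 1)) *
        deriv (fun t : ℝ => t ^ (n - l) * (u' t / Real.sqrt (1 + u' t ^ 2)) ^ l) r := by
  obtain ⟨m, rfl⟩ : ∃ m, n = m + 1 := ⟨n - 1, by omega⟩
  obtain ⟨k, rfl⟩ : ∃ k, l = k + 1 := ⟨l - 1, by omega⟩
  obtain ⟨d, rfl⟩ : ∃ d, m = k + d := ⟨m - k, by omega⟩
  have hr0 : r ≠ 0 := (ha.trans_lt hr.1).ne'
  have huniv : (Finset.univ : Finset (Fin (k + d + 1))) =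
      insert (Fin.last (k + d)) (Finset.univ.erase (Fin.last (k + d))) :=
    (Finset.insert_erase (Finset.mem_univ _)).symm
  have hφ := (hu' r hr).div_sqrt_one_add_sq
  have hderiv := (((hasDerivAt_id r).fun_pow d).fun_mul (hφ.fun_pow (k + 1))).deriv
  have hsub : k + d + 1 - (k + 1) = d := by omega
  simp only [id] at hderiv
  rw [esymmVec, huniv, sum_powersetCard_succ_insert_prod_of_const
    (p := u' r / Real.sqrt (1 + u' r ^ 2) / r) (Finset.notMem_erase _ _), hsub, hderiv]
  · have hchoose : ((k + d).choose (k + 1) : ℝ) * (k + 1) = (k + d).choose k * d := by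
      have h := Nat.choose_succ_right_eq (k + d) k
      rw [Nat.add_sub_cancel_left] at h
      exact_mod_cast h
    simp only [Finset.card_erase_of_mem (Finset.mem_univ _), Finset.card_univ, Fintype.card_fin,
      Nat.add_sub_cancel, Fin.val_last, lt_irrefl, if_false]
    have hk : (k : ℝ) + 1 ≠ 0 := by positivity
    rw [eq_div_of_mul_eq hk hchoose]
    generalize u' r / Real.sqrt (1 + u' r ^ 2) = φ
    generalize u'' r / Real.sqrt (1 + u' r ^ 2) ^ 3 = q
    push_cast
    cases d with
    | zero =>
      simp only [Nat.cast_zero, add_zero, div_pow]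
      field_simp
      ring
    | succ d =>
      simp only [Nat.add_sub_cancel, pow_succ, pow_add, div_pow]
      field_simp
  · intro i hi
    have hne := Finset.ne_of_mem_erase hi
    have hlt : (i : ℕ) < k + d + 1 - 1 := Fin.val_lt_last hne
    rw [if_pos hlt, div_div, mul_comm]
end

section
/- Let n ≥ 2 and 0 ≤ k ≤ n−1 be integers, let u be twice differentiable at r > 0, and define λ ∈ ℝⁿ by λ_i = u'(r)/(r√(1 + u'(r)²)) for i = 1, …, n−1 and λ_n = u''(r)/(1 + u'(r)²)^{3/2}. Assume e_k(λ) ≠ 0 and (n−k)(1 + u'(r)²)u'(r) + k r u''(r) ≠ 0. Then e_{k+1}(λ)/e_k(λ) = [(n−k)/((k+1) r √(1 + u'(r)²))] · [ (n−k−1)(1 + u'(r)²)u'(r)² + (k+1) r u''(r) u'(r) ] / [ (n−k)(1 + u'(r)²)u'(r) + k r u''(r) ]. -/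
open Finset in
theorem sum_powersetCard_prod_eq_of_forall_eq {ι R : Type*} [CommSemiring R] {S : Finset ι}
    {f : ι → R} {a : R} (hf : ∀ i ∈ S, f i = a) (l : ℕ) :
    ∑ s ∈ S.powersetCard l, ∏ i ∈ s, f i = (S.card.choose l : R) * a ^ l := by
  have h : ∀ s ∈ S.powersetCard l, ∏ i ∈ s, f i = a ^ l := by
    intro s hs
    obtain ⟨hsS, hcard⟩ := mem_powersetCard.1 hs
    rw [prod_congr rfl fun i hi => hf i (hsS hi), prod_const, hcard]
  rw [sum_congr rfl h, sum_const, card_powersetCard, nsmul_eq_mul]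

theorem esymmVec_zero (n : ℕ) (lam : Fin n → ℝ) : esymmVec n 0 lam = 1 := by
  simp [esymmVec]

open Finset in
/-- Elementary symmetric polynomials of a vector all of whose entries but the last agree. -/
theorem esymmVec_succ_ite (m l : ℕ) (a b : ℝ) :
    esymmVec (m + 1) (l + 1) (fun i => if (i : ℕ) < m then a else b) =
      (m.choose (l + 1) : ℝ) * a ^ (l + 1) + (m.choose l : ℝ) * a ^ l * b := by
  classical
  set f : Fin (m + 1) → ℝ := fun i => if (i : ℕ) < m then a else b
  set S : Finset (Fin (m + 1)) := univ.erase (Fin.last m)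
  have hlast : Fin.last m ∉ S := notMem_erase _ _
  have hcard : S.card = m := by simp [S]
  have hf : ∀ i ∈ S, f i = a := fun i hi =>
    if_pos (Fin.val_lt_last (ne_of_mem_erase hi))
  have hinj : Set.InjOn (insert (Fin.last m)) (S.powersetCard l : Set (Finset (Fin (m + 1)))) := by
    intro s hs t ht hst
    have hs' : Fin.last m ∉ s := fun h => hlast ((mem_powersetCard.1 hs).1 h)
    have ht' : Fin.last m ∉ t := fun h => hlast ((mem_powersetCard.1 ht).1 h)
    rw [← erase_insert hs', ← erase_insert ht', hst]
  have hdisj : Disjoint (S.powersetCard (l + 1))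
      ((S.powersetCard l).image (insert (Fin.last m))) := by
    rw [disjoint_left]
    intro s hs hs'
    obtain ⟨t, -, rfl⟩ := mem_image.1 hs'
    exact hlast ((mem_powersetCard.1 hs).1 (mem_insert_self _ _))
  have hprod : ∀ s ∈ S.powersetCard l,
      ∏ i ∈ insert (Fin.last m) s, f i = (∏ i ∈ s, f i) * b := by
    intro s hs
    rw [prod_insert fun h => hlast ((mem_powersetCard.1 hs).1 h), mul_comm]
    simp [f]
  rw [esymmVec, ← insert_erase (mem_univ (Fin.last m)), powersetCard_succ_insert hlast,
    sum_union hdisj, sum_image hinj, sum_congr rfl hprod, ← sum_mul,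
    sum_powersetCard_prod_eq_of_forall_eq hf, sum_powersetCard_prod_eq_of_forall_eq hf, hcard]

theorem Nat.cast_choose_succ_eq_div {K : Type*} [Field K] [CharZero K] (m j : ℕ) :
    (m.choose (j + 1) : K) = m.choose j * ((m : K) - j) / (j + 1) := by
  rw [eq_div_iff (Nat.cast_add_one_ne_zero j)]
  rcases le_or_gt j m with h | h
  · rw [← Nat.cast_sub h]
    exact_mod_cast Nat.choose_succ_right_eq m j
  · simp [Nat.choose_eq_zero_of_lt h, Nat.choose_eq_zero_of_lt (h.trans (Nat.lt_succ_self j))]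

theorem esymmVec_ite_succ_mul (m k : ℕ) (a b : ℝ) :
    esymmVec (m + 1) (k + 1) (fun i => if (i : ℕ) < m then a else b) *
        ((k + 1) * (((m : ℝ) + 1 - k) * a + k * b)) =
      ((m : ℝ) + 1 - k) * a * (((m : ℝ) - k) * a + (k + 1) * b) *
        esymmVec (m + 1) k (fun i => if (i : ℕ) < m then a else b) := by
  cases k with
  | zero =>
    rw [esymmVec_succ_ite, esymmVec_zero]
    simp
    ring
  | succ j =>
    rw [esymmVec_succ_ite, esymmVec_succ_ite, Nat.cast_choose_succ_eq_div m (j + 1),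
      Nat.cast_choose_succ_eq_div m j]
    have h₁ : (j : ℝ) + 1 ≠ 0 := by positivity
    have h₂ : (j : ℝ) + 1 + 1 ≠ 0 := by positivity
    push_cast
    field_simp
    ring

/-- For a rotationally symmetric graph in `ℝ^{n+1}` with profile `u`, twice
differentiable at `r > 0` with `u'(r) = p` and `u''(r) = q`, whose principal curvatures
are `λ₁ = ⋯ = λ_{n-1} = p/(r√(1+p²))` and `λ_n = q/(1+p²)^{3/2}`, the quotient
`Q_k(λ) = e_{k+1}(λ)/e_k(λ)` is given by the stated explicit formula, provided
`e_k(λ) ≠ 0` and `(n-k)(1+p²)p + k r q ≠ 0`. -/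
theorem qk_principal_curvatures_rotationally_symmetric
    (n k : ℕ) (hn : 2 ≤ n) (hk : k ≤ n - 1)
    (u : ℝ → ℝ) (r : ℝ) (hr : 0 < r) (p q : ℝ)
    (hu : HasDerivAt u p r) (hu' : HasDerivAt (deriv u) q r)
    (hek : esymmVec n k (fun i =>
        if (i : ℕ) < n - 1 then p / (r * Real.sqrt (1 + p ^ 2))
        else q / (Real.sqrt (1 + p ^ 2)) ^ 3) ≠ 0)
    (hden : ((n : ℝ) - k) * (1 + p ^ 2) * p + (k : ℝ) * r * q ≠ 0) :
    esymmVec n (k + 1) (fun i =>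
        if (i : ℕ) < n - 1 then p / (r * Real.sqrt (1 + p ^ 2))
        else q / (Real.sqrt (1 + p ^ 2)) ^ 3) /
      esymmVec n k (fun i =>
        if (i : ℕ) < n - 1 then p / (r * Real.sqrt (1 + p ^ 2))
        else q / (Real.sqrt (1 + p ^ 2)) ^ 3) =
      (((n : ℝ) - k) / (((k : ℝ) + 1) * r * Real.sqrt (1 + p ^ 2))) *
        ((((n : ℝ) - k - 1) * (1 + p ^ 2) * p ^ 2 + ((k : ℝ) + 1) * r * q * p) /
          (((n : ℝ) - k) * (1 + p ^ 2) * p + (k : ℝ) * r * q)) := by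
  obtain ⟨m, rfl⟩ : ∃ m, n = m + 1 := ⟨n - 1, by omega⟩
  simp only [Nat.add_sub_cancel] at hek ⊢
  have key := esymmVec_ite_succ_mul m k (p / (r * √(1 + p ^ 2))) (q / √(1 + p ^ 2) ^ 3)
  set E₀ := esymmVec (m + 1) k _
  set E₁ := esymmVec (m + 1) (k + 1) _
  have hs : 0 < √(1 + p ^ 2) := Real.sqrt_pos.2 (by positivity)
  have hs2 : 1 + p ^ 2 = √(1 + p ^ 2) ^ 2 := (Real.sq_sqrt (by positivity)).symm
  set s := √(1 + p ^ 2)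
  rw [hs2] at hden ⊢
  push_cast at hden ⊢
  have hk1 : (k : ℝ) + 1 ≠ 0 := by positivity
  have hD : ((m : ℝ) + 1 - k) * (p / (r * s)) + k * (q / s ^ 3) =
      (((m : ℝ) + 1 - k) * s ^ 2 * p + k * r * q) / (r * s ^ 3) := by
    field_simp
  have hN : ((m : ℝ) - k) * (p / (r * s)) + (k + 1) * (q / s ^ 3) =
      (((m : ℝ) - k) * s ^ 2 * p + (k + 1) * r * q) / (r * s ^ 3) := by
    field_simp
  rw [hD, hN] at key
  set D := ((m : ℝ) + 1 - k) * s ^ 2 * p + k * r * q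
  rw [div_eq_iff hek]
  field_simp at key ⊢
  linear_combination key
end

section
/- Let n ≥ 2 and 1 ≤ k ≤ n−1 be integers, let ρ > 0, and let u₁, u₂ : B_ρ(0) ⊂ ℝⁿ → ℝ be smooth functions such that for i = 1, 2 and every x ∈ B_ρ(0): S_{k+1}(W(u_i)(x)) · √(1 + |∇u_i(x)|²) = S_k(W(u_i)(x)) (both graphs are Q_k-translators in the e_{n+1}-direction). Assume: (1) the Hessian D²u₁(x) is positive definite for every x ∈ B_ρ(0) (the graph of u₁ is strictly convex); (2) the Hessian D²u₂(x) is positive semidefinite and S_l(W(u₂)(x)) > 0 for l = 1, …, k+1, for every x ∈ B_ρ(0) (the principal curvatures of the graph of u₂ lie in Γ_{k+1} ∩ {λ ≥ 0}); (3) u₁(0) = u₂(0) and ∇u₁(0) = ∇u₂(0) (tangency at an interior point); (4) u₁ ≤ u₂ on B_ρ(0) (one graph lies on one side of the other). Then u₁ = u₂ on B_ρ(0). -/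
open scoped Matrix

/-- `i`-th partial derivative `∂ᵢ u x`. -/
noncomputable def partialDeriv1 {n : ℕ} (u : EuclideanSpace ℝ (Fin n) → ℝ)
    (x : EuclideanSpace ℝ (Fin n)) (i : Fin n) : ℝ :=
  fderiv ℝ u x (EuclideanSpace.single i 1)

/-- Hessian matrix `∂ᵢ∂ⱼ u x`. -/
noncomputable def hessianMatrix {n : ℕ} (u : EuclideanSpace ℝ (Fin n) → ℝ)
    (x : EuclideanSpace ℝ (Fin n)) : Matrix (Fin n) (Fin n) ℝ :=
  Matrix.of fun i j =>
    fderiv ℝ (fun y => fderiv ℝ u y (EuclideanSpace.single j 1)) x (EuclideanSpace.single i 1)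

/-- Squared Euclidean norm of the gradient, `|∇u x|²`. -/
noncomputable def gradNormSq {n : ℕ} (u : EuclideanSpace ℝ (Fin n) → ℝ)
    (x : EuclideanSpace ℝ (Fin n)) : ℝ :=
  ∑ i, (partialDeriv1 u x i) ^ 2

/-- The Weingarten matrix of the graph of `u`,
`Wⁱⱼ = Σₖ (δᵢₖ/√(1+|∇u|²) − ∂ᵢu ∂ₖu/(1+|∇u|²)^{3/2}) ∂ₖ∂ⱼu`. -/
noncomputable def weingartenMatrix {n : ℕ} (u : EuclideanSpace ℝ (Fin n) → ℝ)
    (x : EuclideanSpace ℝ (Fin n)) : Matrix (Fin n) (Fin n) ℝ :=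
  Matrix.of fun i j =>
    ∑ k, ((if i = k then (1 : ℝ) else 0) / Real.sqrt (1 + gradNormSq u x) -
        partialDeriv1 u x i * partialDeriv1 u x k / (Real.sqrt (1 + gradNormSq u x)) ^ 3) *
      hessianMatrix u x k j

/-- `S_l(W)`, the `l`-th elementary symmetric function of the eigenvalues of `W`,
defined via `det(I + t W) = Σ_l S_l(W) tˡ`. -/
noncomputable def symFunc {n : ℕ} (W : Matrix (Fin n) (Fin n) ℝ) (l : ℕ) : ℝ :=
  (Matrix.det (1 + (Polynomial.X : Polynomial ℝ) • W.map Polynomial.C)).coeff l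

open Polynomial in
/-- The coefficients of a product of linear factors `1 + a X` with `a > 0` are positive up to the
degree and strictly log-concave. -/
lemma coeff_prod_one_add_C_mul_X {ι : Type*} [DecidableEq ι] (a : ι → ℝ) (ha : ∀ i, 0 < a i)
    (s : Finset ι) :
    (∀ l, 0 ≤ (∏ i ∈ s, (1 + C (a i) * X)).coeff l) ∧
    (∀ l ≤ s.card, 0 < (∏ i ∈ s, (1 + C (a i) * X)).coeff l) ∧
    (∀ i j, i ≤ j → (∏ i ∈ s, (1 + C (a i) * X)).coeff i * (∏ i ∈ s, (1 + C (a i) * X)).coeff (j + 1)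
      ≤ (∏ i ∈ s, (1 + C (a i) * X)).coeff (i + 1) * (∏ i ∈ s, (1 + C (a i) * X)).coeff j) ∧
    (∀ l < s.card, (∏ i ∈ s, (1 + C (a i) * X)).coeff l * (∏ i ∈ s, (1 + C (a i) * X)).coeff (l + 2)
      < (∏ i ∈ s, (1 + C (a i) * X)).coeff (l + 1) ^ 2) := by
  induction s using Finset.induction_on with
  | empty =>
    simp only [Finset.prod_empty, coeff_one, Finset.card_empty]
    refine ⟨fun l => by split_ifs <;> norm_num, fun l hl => ?_, fun i j _ => by simp, by simp⟩
    rw [if_pos (by omega)]; norm_num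
  | insert i₀ s hi ih =>
    rw [Finset.card_insert_of_notMem hi, Finset.prod_insert hi]
    generalize (∏ i ∈ s, (1 + C (a i) * X)) = P at ih ⊢
    obtain ⟨h0, hpos, hlc, hstrict⟩ := ih
    have hc := ha i₀
    generalize a i₀ = c at hc ⊢
    have hz : ((1 + C c * X) * P).coeff 0 = P.coeff 0 := by simp [add_mul, mul_assoc]
    have hs : ∀ l, ((1 + C c * X) * P).coeff (l + 1) = P.coeff (l + 1) + c * P.coeff l := by
      intro l; simp [add_mul, mul_assoc]
    refine ⟨fun l => ?_, fun l hl => ?_, fun i j hij => ?_, fun l hl => ?_⟩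
    · cases l with
      | zero => rw [hz]; exact h0 0
      | succ l => rw [hs]; have := h0 l; have := h0 (l + 1); positivity
    · cases l with
      | zero => rw [hz]; exact hpos 0 (by omega)
      | succ l => rw [hs]; have := hpos l (by omega); have := h0 (l + 1); positivity
    · cases i with
      | zero =>
        rw [hz, hs, hs]
        cases j with
        | zero => rw [hz]; nlinarith
        | succ j =>
          rw [hs]
          have e1 := hlc 0 (j + 1) (by omega)
          have e2 := mul_nonneg (mul_nonneg hc.le (h0 (0 + 1))) (h0 j)
          have e3 := mul_nonneg (mul_nonneg (mul_nonneg hc.le hc.le) (h0 0)) (h0 j)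
          nlinarith
      | succ i =>
        obtain ⟨j, rfl⟩ : ∃ m, j = m + 1 := ⟨j - 1, by omega⟩
        simp only [hs]
        have e1 := hlc (i + 1) (j + 1) (by omega)
        have e2 := mul_le_mul_of_nonneg_left (hlc i j (by omega)) (mul_nonneg hc.le hc.le)
        have e3 : P.coeff i * P.coeff (j + 1 + 1) ≤ P.coeff (i + 1 + 1) * P.coeff j := by
          rcases Nat.lt_or_ge i j with h | h
          · exact (hlc i (j + 1) (by omega)).trans (hlc (i + 1) j (by omega))
          · obtain rfl : i = j := by omega
            rw [mul_comm]
        have e4 := mul_le_mul_of_nonneg_left e3 hc.le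
        nlinarith
    · cases l with
      | zero =>
        rw [hz, hs, hs]
        have e1 := hlc 0 1 (by omega)
        have p0 := hpos 0 (by omega)
        have e2 := mul_nonneg (mul_nonneg hc.le (h0 (0 + 1))) (h0 0)
        have e3 : 0 < c * c * (P.coeff 0 * P.coeff 0) := by positivity
        simp only [zero_add, Nat.reduceAdd] at *
        nlinarith
      | succ l =>
        simp only [hs]
        have e1 := hlc (l + 1) (l + 2) (by omega)
        have e2 := mul_lt_mul_of_pos_left (hstrict l (by omega)) (mul_pos hc hc)
        have e3 := mul_le_mul_of_nonneg_left ((hlc l (l + 2) (by omega)).trans (hlc (l + 1) (l + 1) (by omega))) hc.le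
        simp only [add_assoc, Nat.reduceAdd] at *
        nlinarith

lemma det_diagonal_add_vecMulVec {R : Type*} [CommRing R] [IsDomain R] {ι : Type*} [Fintype ι]
    [DecidableEq ι] (d : ι → R) (hd : ∀ i, d i ≠ 0) (u v : ι → R) :
    (Matrix.diagonal d + Matrix.vecMulVec u v).det =
      ∏ i, d i + ∑ i, u i * v i * ∏ j ∈ Finset.univ.erase i, d j := by
  apply IsFractionRing.injective R (FractionRing R)
  set f := algebraMap R (FractionRing R)
  have hd' : ∀ i, f (d i) ≠ 0 := fun i => by
    simpa using (map_ne_zero_iff f (IsFractionRing.injective R (FractionRing R))).2 (hd i)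
  have e : f.mapMatrix (Matrix.diagonal d + Matrix.vecMulVec u v) =
      Matrix.diagonal (fun i => f (d i)) *
        (1 + Matrix.vecMulVec (fun i => (f (d i))⁻¹ * f (u i)) (fun i => f (v i))) := by
    ext i j
    simp only [RingHom.mapMatrix_apply, Matrix.map_apply, Matrix.add_apply, Matrix.vecMulVec_apply,
      map_add, map_mul, Matrix.diagonal_mul, mul_add, Matrix.one_apply, Matrix.diagonal_apply]
    have := hd' i
    split_ifs
    · field_simp
    · field_simp
      simp
  rw [RingHom.map_det, e, Matrix.det_mul, Matrix.det_diagonal, Matrix.vecMulVec_eq Unit,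
    Matrix.det_one_add_replicateCol_mul_replicateRow, mul_add, mul_one, map_add, map_prod, map_sum,
    dotProduct, Finset.mul_sum]
  congr 1
  refine Finset.sum_congr rfl fun i _ => ?_
  rw [← Finset.mul_prod_erase _ _ (Finset.mem_univ i), map_mul, map_mul, map_prod]
  have := hd' i
  field_simp

/-- Simultaneous diagonalization by congruence of two positive definite matrices. -/
lemma exists_congruence_diagonal {ι : Type*} [Fintype ι] [DecidableEq ι] {A H : Matrix ι ι ℝ}
    (hA : A.PosDef) (hH : H.PosDef) :
    ∃ (P : Matrix ι ι ℝ) (a : ι → ℝ), IsUnit P ∧ (∀ i, 0 < a i) ∧ Pᵀ * P = A ∧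
      P * H * Pᵀ = Matrix.diagonal a := by
  have hspec : ∀ {M : Matrix ι ι ℝ}, M.PosDef → ∃ (V : Matrix ι ι ℝ) (a : ι → ℝ),
      (∀ i, 0 < a i) ∧ Vᵀ * V = 1 ∧ V * Vᵀ = 1 ∧ M = V * Matrix.diagonal a * Vᵀ := by
    intro M hM
    refine ⟨hM.1.eigenvectorUnitary, hM.1.eigenvalues, hM.eigenvalues_pos, ?_, ?_, ?_⟩
    · have := Unitary.coe_star_mul_self hM.1.eigenvectorUnitary
      simpa [Matrix.star_eq_conjTranspose] using this
    · have := Unitary.coe_mul_star_self hM.1.eigenvectorUnitary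
      simpa [Matrix.star_eq_conjTranspose] using this
    · have := hM.1.spectral_theorem
      rw [Unitary.conjStarAlgAut_apply] at this
      simpa [Matrix.star_eq_conjTranspose] using this
  obtain ⟨V, d, hd, hV1, hV2, hAV⟩ := hspec hA
  set B : Matrix ι ι ℝ := Matrix.diagonal (fun i => Real.sqrt (d i)) * Vᵀ with hB
  have hBA : Bᵀ * B = A := by
    rw [hB, Matrix.transpose_mul, Matrix.transpose_transpose, Matrix.diagonal_transpose, hAV,
      Matrix.mul_assoc, ← Matrix.mul_assoc (Matrix.diagonal _) (Matrix.diagonal _) Vᵀ,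
      Matrix.diagonal_mul_diagonal, ← Matrix.mul_assoc]
    simp only [Real.mul_self_sqrt (hd _).le]
  have hBu : IsUnit B := by
    refine IsUnit.mul ?_ ?_
    · rw [Matrix.isUnit_diagonal, Pi.isUnit_iff]
      exact fun i => (Real.sqrt_pos.2 (hd i)).ne'.isUnit
    · exact IsUnit.of_mul_eq_one V hV1
  have hK : (B * H * Bᵀ).PosDef := by
    have := hH.mul_mul_conjTranspose_same (B := B)
      (Matrix.vecMul_injective_of_isUnit hBu)
    simpa using this
  obtain ⟨U, a, ha, hU1, hU2, hBU⟩ := hspec hK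
  refine ⟨Uᵀ * B, a, (IsUnit.of_mul_eq_one U hU1).mul hBu, ha, ?_, ?_⟩
  · rw [Matrix.transpose_mul, Matrix.transpose_transpose, Matrix.mul_assoc,
      ← Matrix.mul_assoc U, hU2, Matrix.one_mul, hBA]
  · calc Uᵀ * B * H * (Uᵀ * B)ᵀ = Uᵀ * (B * H * Bᵀ) * U := by
          simp only [Matrix.transpose_mul, Matrix.transpose_transpose, Matrix.mul_assoc]
      _ = (Uᵀ * U) * Matrix.diagonal a * (Uᵀ * U) := by
          rw [hBU]; simp only [Matrix.mul_assoc]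
      _ = Matrix.diagonal a := by rw [hU1, Matrix.one_mul, Matrix.mul_one]

open Polynomial in
lemma det_one_add_X_smul_mul_comm {n : ℕ} (P Q : Matrix (Fin n) (Fin n) ℝ) :
    (1 + (X : ℝ[X]) • (P * Q).map C).det = (1 + (X : ℝ[X]) • (Q * P).map C).det := by
  rw [Matrix.map_mul, Matrix.map_mul, ← Matrix.smul_mul, Matrix.det_one_add_mul_comm,
    Matrix.mul_smul]

open Polynomial in
/-- Along a rank-one increment of a positive definite matrix `H`, the functions `S_l (A H)` are
affine and the quotients `S_{k+1} / S_k` have positive slope. -/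
lemma symFunc_mul_add_smul_vecMulVec {n : ℕ} {A H : Matrix (Fin n) (Fin n) ℝ}
    (hA : A.PosDef) (hH : H.PosDef) {ξ : Fin n → ℝ} (hξ : ξ ≠ 0) :
    ∃ c : ℕ → ℝ, (∀ t l, symFunc (A * (H + t • Matrix.vecMulVec ξ ξ)) l =
        symFunc (A * H) l + t * c l) ∧
      (∀ l ≤ n, 0 < symFunc (A * H) l) ∧ (∀ l, 0 ≤ c l) ∧
      ∀ k < n, c k * symFunc (A * H) (k + 1) < c (k + 1) * symFunc (A * H) k := by
  obtain ⟨P, a, hP, ha, hPA, hPH⟩ := exists_congruence_diagonal hA hH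
  set η := P *ᵥ ξ with hη
  have hη0 : ∃ i, η i ≠ 0 := by
    by_contra! h
    exact hξ (Matrix.mulVec_injective_of_isUnit hP (by rw [Matrix.mulVec_zero]; exact funext h))
  set D : Polynomial ℝ := ∏ i, (1 + C (a i) * X) with hD
  set E : Fin n → Polynomial ℝ := fun i => ∏ j ∈ Finset.univ.erase i, (1 + C (a j) * X) with hE
  have hdet : ∀ t : ℝ, (1 + (X : ℝ[X]) • (A * (H + t • Matrix.vecMulVec ξ ξ)).map C).det =
      D + ∑ i, C (t * η i ^ 2) * (E i * X) := by
    intro t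
    have h1 : P * (H + t • Matrix.vecMulVec ξ ξ) * Pᵀ =
        Matrix.diagonal a + t • Matrix.vecMulVec η η := by
      rw [Matrix.mul_add, Matrix.add_mul, hPH, Matrix.mul_smul, Matrix.smul_mul,
        Matrix.mul_vecMulVec, Matrix.vecMulVec_mul, Matrix.vecMul_transpose]
    have h2 : (1 : Matrix (Fin n) (Fin n) ℝ[X]) + (X : ℝ[X]) •
          (Matrix.diagonal a + t • Matrix.vecMulVec η η).map C =
        Matrix.diagonal (fun i => 1 + C (a i) * X) +
          Matrix.vecMulVec (fun i => C (t * η i) * X) (fun i => C (η i)) := by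
      ext1 i j
      by_cases hij : i = j
      · subst hij
        simp [Matrix.vecMulVec_apply]
        ring
      · simp [Matrix.vecMulVec_apply, hij]
        ring
    rw [← hPA, Matrix.mul_assoc, det_one_add_X_smul_mul_comm, h1, h2,
      det_diagonal_add_vecMulVec]
    · congr 1
      refine Finset.sum_congr rfl fun i _ => ?_
      simp only [hE, map_mul, map_pow]
      ring
    · intro i h
      simpa using congrArg (fun p => p.coeff 0) h
  have hS : ∀ l, symFunc (A * H) l = D.coeff l := by
    intro l
    have := hdet 0
    simp only [zero_smul, add_zero, zero_mul, map_zero, Finset.sum_const_zero] at this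
    rw [symFunc, this]
  have hDE : ∀ i, D = (1 + C (a i) * X) * E i := fun i =>
    (Finset.mul_prod_erase _ _ (Finset.mem_univ i)).symm
  have hcard : ∀ i : Fin n, (Finset.univ.erase i).card = n - 1 := fun i => by simp
  refine ⟨fun l => ∑ i, η i ^ 2 * (E i * X).coeff l, fun t l => ?_, fun l hl => ?_, fun l => ?_,
    fun k hk => ?_⟩
  · rw [hS, symFunc, hdet, coeff_add, finsetSum_coeff, Finset.mul_sum]
    simp only [coeff_C_mul, mul_assoc]
  · rw [hS]
    exact (coeff_prod_one_add_C_mul_X a ha Finset.univ).2.1 l (by simpa using hl)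
  · refine Finset.sum_nonneg fun i _ => mul_nonneg (sq_nonneg _) ?_
    cases l with
    | zero => simp
    | succ l =>
      rw [coeff_mul_X]
      exact (coeff_prod_one_add_C_mul_X a ha _).1 l
  · rw [hS, hS, Finset.sum_mul, Finset.sum_mul]
    have key : ∀ i, (E i * X).coeff k * D.coeff (k + 1) < (E i * X).coeff (k + 1) * D.coeff k := by
      intro i
      obtain ⟨-, hpos, -, hlc⟩ := coeff_prod_one_add_C_mul_X a ha (Finset.univ.erase i)
      rw [hcard] at hpos hlc
      rw [hDE i, coeff_mul_X]
      have hs : ∀ l, ((1 + C (a i) * X) * E i).coeff (l + 1) =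
          (E i).coeff (l + 1) + a i * (E i).coeff l := by
        intro l; simp [add_mul, mul_assoc]
      cases k with
      | zero =>
        have := hpos 0 (by omega)
        simpa [add_mul, mul_assoc] using mul_pos this this
      | succ m =>
        rw [coeff_mul_X, hs, hs]
        have := hlc m (by omega)
        simp only [hE, add_assoc, Nat.reduceAdd] at this ⊢
        nlinarith
    obtain ⟨i₀, hi₀⟩ := hη0
    refine Finset.sum_lt_sum (fun i _ => ?_) ⟨i₀, Finset.mem_univ _, ?_⟩
    · rw [mul_assoc, mul_assoc]
      exact mul_le_mul_of_nonneg_left (key i).le (sq_nonneg _)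
    · rw [mul_assoc, mul_assoc]
      exact mul_lt_mul_of_pos_left (key i₀) (by positivity)

lemma translator_rank_one {n k : ℕ} (hk : k < n) {w : ℝ} (hw : 0 < w)
    {A H : Matrix (Fin n) (Fin n) ℝ} (hA : A.PosDef) (hH : H.PosDef)
    {ξ : Fin n → ℝ} (hξ : ξ ≠ 0)
    (h : 0 ≤ symFunc (A * H) (k + 1) * w - symFunc (A * H) k) :
    ∃ m > 0, ∀ t, symFunc (A * (H + t • Matrix.vecMulVec ξ ξ)) (k + 1) * w -
      symFunc (A * (H + t • Matrix.vecMulVec ξ ξ)) k =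
        symFunc (A * H) (k + 1) * w - symFunc (A * H) k + t * m := by
  obtain ⟨c, hc, hpos, hc0, hlt⟩ := symFunc_mul_add_smul_vecMulVec hA hH hξ
  refine ⟨c (k + 1) * w - c k, ?_, fun t => by rw [hc, hc]; ring⟩
  have h1 := hpos (k + 1) (by omega)
  have h2 := mul_lt_mul_of_pos_left (hlt k hk) hw
  have h3 := mul_le_mul_of_nonneg_left h (hc0 (k + 1))
  refine pos_of_mul_pos_left (b := symFunc (A * H) (k + 1)) ?_ h1.le
  nlinarith

/-- The translator operator stays positive when a positive semidefinite matrix is added. -/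
lemma translator_add_posSemidef {n k : ℕ} (hk : k < n) {w : ℝ} (hw : 0 < w)
    {A H M : Matrix (Fin n) (Fin n) ℝ} (hA : A.PosDef) (hH : H.PosDef) (hM : M.PosSemidef)
    (h : 0 < symFunc (A * H) (k + 1) * w - symFunc (A * H) k) :
    0 < symFunc (A * (H + M)) (k + 1) * w - symFunc (A * (H + M)) k := by
  obtain ⟨m, v, rfl⟩ := Matrix.posSemidef_iff_eq_sum_vecMulVec.1 hM
  simp only [star_trivial]
  suffices main : ∀ s : Finset (Fin m), (H + ∑ i ∈ s, Matrix.vecMulVec (v i) (v i)).PosDef ∧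
      0 < symFunc (A * (H + ∑ i ∈ s, Matrix.vecMulVec (v i) (v i))) (k + 1) * w -
        symFunc (A * (H + ∑ i ∈ s, Matrix.vecMulVec (v i) (v i))) k from (main Finset.univ).2
  intro s
  induction s using Finset.induction_on with
  | empty => exact ⟨by simpa using hH, by simpa using h⟩
  | insert i s hi ih =>
    rw [Finset.sum_insert hi, add_comm (Matrix.vecMulVec _ _), ← add_assoc]
    obtain ⟨hP, h0⟩ := ih
    generalize H + ∑ i ∈ s, Matrix.vecMulVec (v i) (v i) = K at *
    by_cases hv : v i = 0
    · simpa only [hv, Matrix.zero_vecMulVec, add_zero] using ⟨hP, h0⟩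
    · obtain ⟨c, hc, hct⟩ := translator_rank_one hk hw hA hP hv h0.le
      have := hct 1
      rw [one_smul, one_mul] at this
      rw [this]
      have hvv : (Matrix.vecMulVec (v i) (v i)).PosSemidef := by
        simpa using Matrix.posSemidef_vecMulVec_self_star (v i)
      exact ⟨hP.add_posSemidef hvv, by positivity⟩

/-- The symmetric matrix `δᵢₖ/√(1+|p|²) − pᵢpₖ/(1+|p|²)^{3/2}`. -/
noncomputable def shapeFactor {n : ℕ} (p : Fin n → ℝ) : Matrix (Fin n) (Fin n) ℝ :=
  Matrix.of fun i k => (if i = k then (1 : ℝ) else 0) / Real.sqrt (1 + ∑ j, p j ^ 2) -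
    p i * p k / Real.sqrt (1 + ∑ j, p j ^ 2) ^ 3

/-- The translator operator `S_{k+1}(W) √(1+|p|²) − S_k(W)` as a function of the gradient `p` and
the Hessian. -/
noncomputable def translatorOp {n : ℕ} (k : ℕ) (J : (Fin n → ℝ) × (Fin n → Fin n → ℝ)) : ℝ :=
  symFunc (shapeFactor J.1 * Matrix.of J.2) (k + 1) * Real.sqrt (1 + ∑ j, J.1 j ^ 2) -
    symFunc (shapeFactor J.1 * Matrix.of J.2) k

/-- The gradient and the Hessian of `u` at `x`. -/
noncomputable def jet {n : ℕ} (u : EuclideanSpace ℝ (Fin n) → ℝ) (x : EuclideanSpace ℝ (Fin n)) :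
    (Fin n → ℝ) × (Fin n → Fin n → ℝ) :=
  (partialDeriv1 u x, fun i j => hessianMatrix u x i j)

lemma translatorOp_jet {n k : ℕ} (u : EuclideanSpace ℝ (Fin n) → ℝ)
    (x : EuclideanSpace ℝ (Fin n)) :
    translatorOp k (jet u x) = symFunc (weingartenMatrix u x) (k + 1) *
      Real.sqrt (1 + gradNormSq u x) - symFunc (weingartenMatrix u x) k := rfl

lemma sqrt_one_add_sum_sq_pos {ι : Type*} [Fintype ι] (p : ι → ℝ) :
    0 < Real.sqrt (1 + ∑ j, p j ^ 2) := by
  have : 0 ≤ ∑ j, p j ^ 2 := Finset.sum_nonneg fun j _ => sq_nonneg _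
  exact Real.sqrt_pos.2 (by linarith)

lemma shapeFactor_posDef {n : ℕ} (p : Fin n → ℝ) : (shapeFactor p).PosDef := by
  refine Matrix.PosDef.of_dotProduct_mulVec_pos ?_ fun v hv => ?_
  · ext i j
    simp only [shapeFactor, Matrix.conjTranspose_apply, Matrix.of_apply, star_trivial,
      eq_comm (a := i), mul_comm (p i)]
  · have hw := sqrt_one_add_sum_sq_pos p
    have hw2 : Real.sqrt (1 + ∑ j, p j ^ 2) ^ 2 = 1 + ∑ j, p j ^ 2 :=
      Real.sq_sqrt (by have : 0 ≤ ∑ j, p j ^ 2 := Finset.sum_nonneg fun j _ => sq_nonneg _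
                       linarith)
    have e : star v ⬝ᵥ (shapeFactor p *ᵥ v) =
        (∑ i, v i ^ 2) / Real.sqrt (1 + ∑ j, p j ^ 2) -
          (∑ i, p i * v i) ^ 2 / Real.sqrt (1 + ∑ j, p j ^ 2) ^ 3 := by
      have hmv : ∀ i, (shapeFactor p *ᵥ v) i = v i / Real.sqrt (1 + ∑ j, p j ^ 2) -
          p i * ((∑ j, p j * v j) / Real.sqrt (1 + ∑ j, p j ^ 2) ^ 3) := fun i => by
        simp only [shapeFactor, Matrix.mulVec, dotProduct, Matrix.of_apply, sub_mul,
          Finset.sum_sub_distrib, Finset.sum_div, Finset.mul_sum]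
        congr 1
        · simp [div_eq_inv_mul]
        · exact Finset.sum_congr rfl fun j _ => by ring
      simp only [dotProduct, star_trivial, hmv, mul_sub, Finset.sum_sub_distrib, Finset.sum_div]
      congr 1
      · exact Finset.sum_congr rfl fun j _ => by ring
      · rw [← Finset.sum_div, sq, mul_div_assoc, Finset.sum_mul]
        exact Finset.sum_congr rfl fun j _ => by ring
    rw [e]
    have hcs := Finset.sum_mul_sq_le_sq_mul_sq Finset.univ p v
    have hvpos : 0 < ∑ i, v i ^ 2 := by
      obtain ⟨i, hi⟩ := Function.ne_iff.1 hv
      exact Finset.sum_pos' (fun i _ => sq_nonneg _) ⟨i, Finset.mem_univ _, by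
        have : v i ≠ 0 := hi
        positivity⟩
    generalize Real.sqrt (1 + ∑ j, p j ^ 2) = w at *
    have : (∑ i, v i ^ 2) / w - (∑ i, p i * v i) ^ 2 / w ^ 3 =
        ((∑ i, v i ^ 2) * w ^ 2 - (∑ i, p i * v i) ^ 2) / w ^ 3 := by
      field_simp
    rw [this, hw2]
    apply div_pos _ (by positivity)
    nlinarith

open Polynomial in
lemma contDiff_coeff_prod {E ι : Type*} [NormedAddCommGroup E] [NormedSpace ℝ E] [DecidableEq ι]
    {m : WithTop ℕ∞} (s : Finset ι) {P : ι → E → ℝ[X]}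
    (h : ∀ i l, ContDiff ℝ m fun x => (P i x).coeff l) (l : ℕ) :
    ContDiff ℝ m fun x => (∏ i ∈ s, P i x).coeff l := by
  induction s using Finset.induction_on generalizing l with
  | empty => simpa using contDiff_const
  | insert i s hi ih =>
    simp only [Finset.prod_insert hi, coeff_mul]
    exact ContDiff.sum fun q _ => (h i q.1).mul (ih q.2)

open Polynomial in
lemma contDiff_symFunc {E : Type*} [NormedAddCommGroup E] [NormedSpace ℝ E] {n : ℕ}
    {m : WithTop ℕ∞} {W : E → Matrix (Fin n) (Fin n) ℝ} (h : ∀ i j, ContDiff ℝ m fun x => W x i j)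
    (l : ℕ) : ContDiff ℝ m fun x => symFunc (W x) l := by
  simp only [symFunc, Matrix.det_apply, finsetSum_coeff, coeff_smul]
  refine ContDiff.sum fun σ _ => ContDiff.const_smul _ (contDiff_coeff_prod _ (fun i q => ?_) l)
  simp only [Matrix.add_apply, Matrix.smul_apply, Matrix.map_apply, coeff_add, smul_eq_mul,
    coeff_mul_C]
  exact contDiff_const.add (contDiff_const.mul (h _ _))

lemma contDiff_translatorOp {n : ℕ} (k : ℕ) : ContDiff ℝ 1 (translatorOp (n := n) k) := by
  have hp : ∀ i, ContDiff ℝ 1 fun J : (Fin n → ℝ) × (Fin n → Fin n → ℝ) => J.1 i := fun i =>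
    (contDiff_apply ℝ ℝ i).comp contDiff_fst
  have hH : ∀ i j, ContDiff ℝ 1 fun J : (Fin n → ℝ) × (Fin n → Fin n → ℝ) => J.2 i j := fun i j =>
    (contDiff_apply_apply ℝ ℝ i j).comp contDiff_snd
  have hw : ContDiff ℝ 1 fun J : (Fin n → ℝ) × (Fin n → Fin n → ℝ) =>
      Real.sqrt (1 + ∑ j, J.1 j ^ 2) :=
    (contDiff_const.add (ContDiff.sum fun j _ => (hp j).pow 2)).sqrt fun J =>
      (Real.sqrt_pos.1 (sqrt_one_add_sum_sq_pos J.1)).ne'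
  have hW : ∀ i j, ContDiff ℝ 1 fun J : (Fin n → ℝ) × (Fin n → Fin n → ℝ) =>
      (shapeFactor J.1 * Matrix.of J.2) i j := by
    intro i j
    simp only [Matrix.mul_apply, shapeFactor, Matrix.of_apply]
    refine ContDiff.sum fun q _ => ContDiff.mul (ContDiff.sub ?_ ?_) (hH q j)
    · exact contDiff_const.div hw fun J => (sqrt_one_add_sum_sq_pos J.1).ne'
    · exact ((hp i).mul (hp q)).div (hw.pow 3)
        fun J => (pow_pos (sqrt_one_add_sum_sq_pos J.1) 3).ne'
  exact ((contDiff_symFunc hW _).mul hw).sub (contDiff_symFunc hW _)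

lemma eventually_posDef {ι : Type*} [Fintype ι] {H : ι → ι → ℝ} (hH : (Matrix.of H).PosDef) :
    ∀ᶠ K in nhds H, (Matrix.of K).IsHermitian → (Matrix.of K).PosDef := by
  have hcont : Continuous fun q : (ι → ℝ) × (ι → ι → ℝ) => q.1 ⬝ᵥ (Matrix.of q.2 *ᵥ q.1) := by
    simp only [dotProduct, Matrix.mulVec, Matrix.of_apply]
    fun_prop
  have := (isCompact_sphere (0 : ι → ℝ) 1).eventually_forall_of_forall_eventually
    (x₀ := H) (P := fun K v => 0 < v ⬝ᵥ (Matrix.of K *ᵥ v)) fun v hv => by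
      have hv0 : v ≠ 0 := ne_zero_of_mem_unit_sphere (⟨v, hv⟩ : Metric.sphere (0 : ι → ℝ) 1)
      have hpos : 0 < v ⬝ᵥ (Matrix.of H *ᵥ v) := by simpa using hH.dotProduct_mulVec_pos hv0
      have hc : Continuous fun q : (ι → ι → ℝ) × (ι → ℝ) => q.2 ⬝ᵥ (Matrix.of q.1 *ᵥ q.2) :=
        hcont.comp continuous_swap
      exact hc.continuousAt.eventually (lt_mem_nhds hpos)
  filter_upwards [this] with K hK hKh
  refine Matrix.PosDef.of_dotProduct_mulVec_pos hKh fun v hv => ?_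
  have hnv : 0 < ‖v‖ := norm_pos_iff.2 hv
  have h1 := hK (‖v‖⁻¹ • v) (by simp [norm_smul, hnv.ne'])
  rw [Matrix.mulVec_smul, smul_dotProduct, dotProduct_smul, smul_eq_mul, smul_eq_mul] at h1
  rw [star_trivial]
  have hi : 0 < ‖v‖⁻¹ := inv_pos.2 hnv
  exact pos_of_mul_pos_right (pos_of_mul_pos_right h1 hi.le) hi.le

lemma jet_eq {n : ℕ} {u : EuclideanSpace ℝ (Fin n) → ℝ} {x : EuclideanSpace ℝ (Fin n)}
    (hu : ContDiffAt ℝ 2 u x) :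
    jet u x = (fun i => fderiv ℝ u x (EuclideanSpace.single i 1), fun i j =>
      fderiv ℝ (fderiv ℝ u) x (EuclideanSpace.single i 1) (EuclideanSpace.single j 1)) := by
  have hd : DifferentiableAt ℝ (fderiv ℝ u) x :=
    (hu.fderiv_right (m := 1) (by norm_num)).differentiableAt (by norm_num)
  ext1
  · rfl
  · funext i j
    simp only [jet, hessianMatrix, Matrix.of_apply]
    rw [fderiv_clm_apply hd (differentiableAt_const _)]
    simp

lemma continuousAt_jet {n : ℕ} {u : EuclideanSpace ℝ (Fin n) → ℝ} {x : EuclideanSpace ℝ (Fin n)}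
    (hu : ContDiffAt ℝ 2 u x) : ContinuousAt (jet u) x := by
  have hev : ∀ᶠ y in nhds x, ContDiffAt ℝ 2 u y := hu.eventually (by simp)
  have h1 : ContDiffAt ℝ 1 (fderiv ℝ u) x := hu.fderiv_right (by norm_num)
  have h2 : ContDiffAt ℝ 0 (fderiv ℝ (fderiv ℝ u)) x := h1.fderiv_right (by norm_num)
  refine ContinuousAt.congr (ContinuousAt.prodMk ?_ ?_) (hev.mono fun y hy => (jet_eq hy).symm)
  · exact continuousAt_pi.2 fun i => h1.continuousAt.clm_apply continuousAt_const
  · exact continuousAt_pi.2 fun i => continuousAt_pi.2 fun j =>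
      (h2.continuousAt.clm_apply continuousAt_const).clm_apply continuousAt_const

lemma jet_add {n : ℕ} {u v : EuclideanSpace ℝ (Fin n) → ℝ} {x : EuclideanSpace ℝ (Fin n)}
    (hu : ContDiffAt ℝ 2 u x) (hv : ContDiffAt ℝ 2 v x) :
    jet (fun y => u y + v y) x = jet u x + jet v x := by
  have hd : ∀ {w : EuclideanSpace ℝ (Fin n) → ℝ}, ContDiffAt ℝ 2 w x →
      (∀ᶠ y in nhds x, DifferentiableAt ℝ w y) ∧ DifferentiableAt ℝ (fderiv ℝ w) x := fun hw =>
    ⟨(hw.eventually (by simp)).mono fun y hy => hy.differentiableAt (by norm_num),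
      (hw.fderiv_right (m := 1) (by norm_num)).differentiableAt (by norm_num)⟩
  have he : fderiv ℝ (fun y => u y + v y) =ᶠ[nhds x] fun y => fderiv ℝ u y + fderiv ℝ v y := by
    filter_upwards [(hd hu).1, (hd hv).1] with y h1 h2 using fderiv_fun_add h1 h2
  rw [jet_eq hu, jet_eq hv, jet_eq (hu.add hv), he.fderiv_eq, he.eq_of_nhds,
    fderiv_fun_add (hd hu).2 (hd hv).2]
  rfl

lemma jet_const_mul {n : ℕ} {u : EuclideanSpace ℝ (Fin n) → ℝ} {x : EuclideanSpace ℝ (Fin n)}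
    (hu : ContDiffAt ℝ 2 u x) (c : ℝ) : jet (fun y => c * u y) x = c • jet u x := by
  have he : fderiv ℝ (fun y => c * u y) =ᶠ[nhds x] fun y => c • fderiv ℝ u y := by
    filter_upwards [hu.eventually (by simp)] with y hy
    exact fderiv_const_mul (hy.differentiableAt (by norm_num)) c
  rw [jet_eq hu, jet_eq (contDiffAt_const.mul hu), he.fderiv_eq, he.eq_of_nhds,
    fderiv_fun_const_smul ((hu.fderiv_right (m := 1) (by norm_num)).differentiableAt (by norm_num))]
  rfl

lemma jet_sq_of_eq_zero {n : ℕ} {s : EuclideanSpace ℝ (Fin n) → ℝ} {x : EuclideanSpace ℝ (Fin n)}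
    (hs : ContDiffAt ℝ 2 s x) (h0 : s x = 0) :
    jet (fun y => s y ^ 2) x = (0, fun i j => 2 * (partialDeriv1 s x i * partialDeriv1 s x j)) := by
  have he : fderiv ℝ (fun y => s y ^ 2) =ᶠ[nhds x] fun y => (2 * s y) • fderiv ℝ s y := by
    filter_upwards [hs.eventually (by simp)] with y hy
    rw [fderiv_fun_pow _ (hy.differentiableAt (by norm_num))]
    simp
  have hd : DifferentiableAt ℝ (fderiv ℝ s) x :=
    (hs.fderiv_right (m := 1) (by norm_num)).differentiableAt (by norm_num)
  have hsd : DifferentiableAt ℝ s x := hs.differentiableAt (by norm_num)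
  rw [jet_eq (hs.pow 2), he.fderiv_eq, he.eq_of_nhds, fderiv_fun_smul (hsd.const_mul 2) hd,
    fderiv_const_mul hsd, h0]
  ext1
  · funext i; simp
  · funext i j
    simp [partialDeriv1]
    ring

lemma isHermitian_jet {n : ℕ} {u : EuclideanSpace ℝ (Fin n) → ℝ} {x : EuclideanSpace ℝ (Fin n)}
    (hu : ContDiffAt ℝ 2 u x) : (Matrix.of (jet u x).2).IsHermitian := by
  ext i j
  rw [jet_eq hu]
  exact (hu.isSymmSndFDerivAt (by simp)).eq _ _

lemma snd_fderiv_nonneg_of_isLocalMin {E : Type*} [NormedAddCommGroup E] [NormedSpace ℝ E]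
    {u : E → ℝ} {x : E} (hu : ContDiffAt ℝ 2 u x) (h : IsLocalMin u x) (v : E) :
    0 ≤ fderiv ℝ (fderiv ℝ u) x v v := by
  by_contra! hneg
  have hline : ∀ t : ℝ, HasDerivAt (fun t : ℝ => x + t • v) v t := fun t => by
    simpa using ((hasDerivAt_id t).smul_const v).const_add x
  have hct : Filter.Tendsto (fun t : ℝ => x + t • v) (nhds 0) (nhds x) := by
    simpa [ContinuousAt] using (hline 0).continuousAt
  have hmin : IsLocalMin (fun t : ℝ => u (x + t • v)) 0 := by
    have := hct.eventually h
    simpa [IsLocalMin, IsMinFilter] using this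
  have hd1 : deriv (fun t : ℝ => u (x + t • v)) =ᶠ[nhds 0] fun t => fderiv ℝ u (x + t • v) v := by
    filter_upwards [hct.eventually (hu.eventually (by simp))] with t ht
    exact ((ht.differentiableAt (by norm_num)).hasFDerivAt.comp_hasDerivAt t (hline t)).deriv
  have hd2 : deriv (deriv fun t : ℝ => u (x + t • v)) 0 = fderiv ℝ (fderiv ℝ u) x v v := by
    rw [hd1.deriv_eq]
    have hD : DifferentiableAt ℝ (fderiv ℝ u) x :=
      (hu.fderiv_right (m := 1) (by norm_num)).differentiableAt (by norm_num)
    have hD' : HasFDerivAt (fun y => fderiv ℝ u y v) ((fderiv ℝ (fderiv ℝ u) x).flip v)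
        (x + (0 : ℝ) • v) := by
      simpa using hD.hasFDerivAt.clm_apply (hasFDerivAt_const v x)
    exact (hD'.comp_hasDerivAt 0 (hline 0)).deriv
  have hcont : ContinuousAt (fun t : ℝ => u (x + t • v)) 0 :=
    ContinuousAt.comp (f := fun t : ℝ => x + t • v) (by simpa using hu.continuousAt)
      (hline 0).continuousAt
  have hmax := isLocalMax_of_deriv_deriv_neg (hd2 ▸ hneg) hmin.deriv_eq_zero hcont
  have hconst : (fun t : ℝ => u (x + t • v)) =ᶠ[nhds 0] fun _ => u (x + (0 : ℝ) • v) := by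
    filter_upwards [hmin, hmax] with t h1 h2 using le_antisymm h2 h1
  have h0 : deriv (deriv fun t : ℝ => u (x + t • v)) 0 = 0 := by
    have : deriv (fun t : ℝ => u (x + t • v)) =ᶠ[nhds 0] fun _ => 0 := by
      simpa using hconst.deriv
    simpa using this.deriv_eq
  rw [hd2] at h0
  exact hneg.ne h0

lemma jet_of_isLocalMin {n : ℕ} {u : EuclideanSpace ℝ (Fin n) → ℝ} {x : EuclideanSpace ℝ (Fin n)}
    (hu : ContDiffAt ℝ 2 u x) (h : IsLocalMin u x) :
    (jet u x).1 = 0 ∧ (Matrix.of (jet u x).2).PosSemidef := by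
  constructor
  · rw [jet_eq hu, h.fderiv_eq_zero]; rfl
  · refine Matrix.PosSemidef.of_dotProduct_mulVec_nonneg (isHermitian_jet hu) fun v => ?_
    have hv : WithLp.toLp 2 v = ∑ i, v i • EuclideanSpace.single i (1 : ℝ) := by
      ext j
      simp [Finset.sum_apply, Pi.single_apply]
    have := snd_fderiv_nonneg_of_isLocalMin hu h (WithLp.toLp 2 v)
    rw [hv] at this
    simp only [map_sum, map_smul, sum_apply, smul_apply,
      smul_eq_mul, Finset.mul_sum] at this
    rw [jet_eq hu]
    simp only [dotProduct, Matrix.mulVec, Matrix.of_apply, star_trivial, Finset.mul_sum]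
    refine this.trans_eq ?_
    rw [Finset.sum_comm]
    refine Finset.sum_congr rfl fun i _ => Finset.sum_congr rfl fun j _ => by ring

lemma translatorOp_fderiv_pos {n k : ℕ} (hk : k < n) {J : (Fin n → ℝ) × (Fin n → Fin n → ℝ)}
    (hJ : (Matrix.of J.2).PosDef) (h0 : translatorOp k J = 0) {ξ : Fin n → ℝ} (hξ : ξ ≠ 0) :
    0 < fderiv ℝ (translatorOp k) J (0, fun i j => ξ i * ξ j) := by
  obtain ⟨m, hm, hlin⟩ := translator_rank_one hk (sqrt_one_add_sum_sq_pos J.1)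
    (shapeFactor_posDef J.1) hJ hξ h0.ge
  have hd : HasFDerivAt (translatorOp k) (fderiv ℝ (translatorOp k) J)
      (J + (0 : ℝ) • ((0, fun i j => ξ i * ξ j) : (Fin n → ℝ) × (Fin n → Fin n → ℝ))) := by
    rw [zero_smul, add_zero]
    exact ((contDiff_translatorOp k).differentiable (by norm_num) J).hasFDerivAt
  have h1 := hd.comp_hasDerivAt (0 : ℝ) (((hasDerivAt_id (0 : ℝ)).smul_const
    ((0, fun i j => ξ i * ξ j) : (Fin n → ℝ) × (Fin n → Fin n → ℝ))).const_add J)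
  have he : (translatorOp k ∘ fun t : ℝ =>
      J + t • ((0, fun i j => ξ i * ξ j) : (Fin n → ℝ) × (Fin n → Fin n → ℝ))) =
      fun t => translatorOp k J + t * m := by
    funext t
    have := hlin t
    simp only [translatorOp, Function.comp_apply, Prod.fst_add, Prod.smul_fst, smul_zero, add_zero]
    exact this
  have h2 : HasDerivAt (fun t : ℝ => translatorOp k J + t * m) m 0 := by
    simpa using ((hasDerivAt_id (0 : ℝ)).mul_const m).const_add (translatorOp k J)
  have h3 := (he ▸ h1).unique h2
  simp only [one_smul] at h3
  rw [h3]
  exact hm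

lemma translatorOp_pos_of_le {n k : ℕ} (hk : k < n) {J K : (Fin n → ℝ) × (Fin n → Fin n → ℝ)}
    (hJ : (Matrix.of J.2).PosDef) (h0 : 0 < translatorOp k J) (hfst : K.1 = J.1)
    (hle : (Matrix.of (K - J).2).PosSemidef) : 0 < translatorOp k K := by
  have := translator_add_posSemidef hk (sqrt_one_add_sum_sq_pos J.1) (shapeFactor_posDef J.1) hJ
    hle h0
  have hK : Matrix.of J.2 + Matrix.of (K - J).2 = Matrix.of K.2 := by
    ext i j; simp
  rw [hK] at this
  rwa [translatorOp, hfst]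

/-- Moving from a zero of a strictly differentiable function along a direction in which its
derivative is positive makes the function positive, locally uniformly. -/
lemma eventually_pos_add_smul {E V : Type*} [TopologicalSpace E] [NormedAddCommGroup V]
    [NormedSpace ℝ V] {F : V → ℝ} {L : V →L[ℝ] ℝ} {J H : E → V} {z : E}
    (hF : HasStrictFDerivAt F L (J z)) (hJ : ContinuousAt J z) (hH : ContinuousAt H z)
    (hpos : 0 < L (H z)) (h0 : ∀ᶠ x in nhds z, F (J x) = 0) :
    ∀ᶠ q in nhds (z, (0 : ℝ)), 0 < q.2 → 0 < F (J q.1 + q.2 • H q.1) := by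
  have hc : 0 < L (H z) / (2 * (‖H z‖ + 1)) := by positivity
  have hJ' : ContinuousAt (fun q : E × ℝ => J q.1) (z, 0) :=
    ContinuousAt.comp (f := Prod.fst) hJ continuousAt_fst
  have hH' : ContinuousAt (fun q : E × ℝ => H q.1) (z, 0) :=
    ContinuousAt.comp (f := Prod.fst) hH continuousAt_fst
  have ht : Filter.Tendsto (fun q : E × ℝ => (J q.1 + q.2 • H q.1, J q.1)) (nhds (z, 0))
      (nhds (J z, J z)) := by
    have := (hJ'.add (continuousAt_snd.smul hH')).prodMk hJ'
    simpa [ContinuousAt] using this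
  have hstrict := ht.eventually (hF.isLittleO.def hc)
  have hL : ∀ᶠ q : E × ℝ in nhds (z, 0), L (H z) / 2 < L (H q.1) :=
    (L.continuous.continuousAt.comp hH').eventually (lt_mem_nhds (half_lt_self hpos))
  have hN : ∀ᶠ q : E × ℝ in nhds (z, 0), ‖H q.1‖ < ‖H z‖ + 1 :=
    hH'.norm.eventually (gt_mem_nhds (lt_add_one _))
  have h0' : ∀ᶠ q : E × ℝ in nhds (z, 0), F (J q.1) = 0 :=
    (continuous_fst.tendsto (z, (0 : ℝ))).eventually h0
  filter_upwards [hstrict, hL, hN, h0'] with q h1 h2 h3 h4 hq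
  rw [h4, add_sub_cancel_left, map_smul, smul_eq_mul, norm_smul, Real.norm_of_nonneg hq.le,
    Real.norm_eq_abs] at h1
  have h5 : L (H z) / (2 * (‖H z‖ + 1)) * (q.2 * ‖H q.1‖) ≤ q.2 * (L (H z) / 2) := by
    calc L (H z) / (2 * (‖H z‖ + 1)) * (q.2 * ‖H q.1‖)
        ≤ L (H z) / (2 * (‖H z‖ + 1)) * (q.2 * (‖H z‖ + 1)) := by gcongr
      _ = q.2 * (L (H z) / 2) := by field_simp
  have h6 := mul_lt_mul_of_pos_left h2 hq
  have h7 := (abs_le.1 h1).1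
  linarith

/-- A Hopf-type lemma: two translators with `u₁ ≤ u₂` cannot touch at a boundary point `z` of a
ball on which `u₁ < u₂`. -/
lemma translator_not_touching {n k : ℕ} (hk : k < n) {u₁ u₂ : EuclideanSpace ℝ (Fin n) → ℝ}
    {y z : EuclideanSpace ℝ (Fin n)} (h₁ : ContDiffAt ℝ 2 u₁ z) (h₂ : ContDiffAt ℝ 2 u₂ z)
    (hF₁ : ∀ᶠ x in nhds z, translatorOp k (jet u₁ x) = 0)
    (hF₂ : ∀ᶠ x in nhds z, translatorOp k (jet u₂ x) = 0)
    (hpd : (hessianMatrix u₁ z).PosDef) (hle : ∀ᶠ x in nhds z, u₁ x ≤ u₂ x) (hz : u₁ z = u₂ z)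
    (hzy : z ≠ y) (hlt : ∀ᶠ x in nhds z, dist x y < dist z y → u₁ x < u₂ x) : False := by
  set s : EuclideanSpace ℝ (Fin n) → ℝ := fun x => ‖z - y‖ ^ 2 - ‖x - y‖ ^ 2 with hs
  have hsC : ContDiff ℝ 2 s := contDiff_const.sub ((contDiff_id.sub contDiff_const).norm_sq ℝ)
  have hsz : s z = 0 := by simp [hs]
  have hds : ∀ i, partialDeriv1 s z i = -2 * (z - y) i := by
    intro i
    have : HasFDerivAt s (-(2 • innerSL ℝ (z - y))) z := by
      simpa using ((hasStrictFDerivAt_norm_sq (z - y)).hasFDerivAt.comp z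
        ((hasFDerivAt_id z).sub_const y)).const_sub (‖z - y‖ ^ 2)
    rw [partialDeriv1, this.fderiv]
    simp [EuclideanSpace.inner_single_right]
  have hξ : partialDeriv1 s z ≠ 0 := by
    intro h
    apply hzy
    rw [← sub_eq_zero]
    ext i
    have := congrFun h i
    rw [hds] at this
    simpa using this
  set a : EuclideanSpace ℝ (Fin n) → ℝ := fun x => s x - ‖x - z‖ ^ 2 with ha
  have haC : ContDiff ℝ 2 a := hsC.sub ((contDiff_id.sub contDiff_const).norm_sq ℝ)
  set L := fderiv ℝ (translatorOp k) (jet u₁ z) with hLdef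
  have hLpos : 0 < L (jet (fun x => s x ^ 2) z) := by
    have h := translatorOp_fderiv_pos hk (J := jet u₁ z) hpd hF₁.self_of_nhds hξ
    have e : jet (fun x => s x ^ 2) z =
        (2 : ℝ) • (0, fun i j => partialDeriv1 s z i * partialDeriv1 s z j) := by
      rw [jet_sq_of_eq_zero hsC.contDiffAt hsz]
      ext1
      · simp
      · rfl
    rw [e, map_smul, smul_eq_mul]
    exact mul_pos two_pos h
  obtain ⟨β, hβ⟩ : ∃ β : ℝ, 0 < L (jet a z) + β * L (jet (fun x => s x ^ 2) z) := by
    refine ⟨(1 - L (jet a z)) / L (jet (fun x => s x ^ 2) z), ?_⟩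
    rw [div_mul_cancel₀ _ hLpos.ne']
    linarith
  set b : EuclideanSpace ℝ (Fin n) → ℝ := fun x => a x + β * s x ^ 2 with hb
  have hs2C : ContDiff ℝ 2 fun x => s x ^ 2 := hsC.pow 2
  have hbC : ContDiff ℝ 2 b := haC.add (contDiff_const.mul hs2C)
  have hbz : b z = 0 := by simp [hb, ha, hsz]
  have hLb : 0 < L (jet b z) := by
    rw [hb, jet_add haC.contDiffAt (contDiffAt_const.mul hs2C.contDiffAt),
      jet_const_mul hs2C.contDiffAt, map_add, map_smul, smul_eq_mul]
    exact hβ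
  have hstrict : HasStrictFDerivAt (translatorOp k) L (jet u₁ z) :=
    (contDiff_translatorOp k).contDiffAt.hasStrictFDerivAt (by norm_num)
  have hev1 := eventually_pos_add_smul hstrict (continuousAt_jet h₁)
    (continuousAt_jet hbC.contDiffAt) hLb hF₁
  have hev2 : ∀ᶠ q : EuclideanSpace ℝ (Fin n) × ℝ in nhds (z, 0),
      (Matrix.of (jet u₁ q.1 + q.2 • jet b q.1).2).IsHermitian →
        (Matrix.of (jet u₁ q.1 + q.2 • jet b q.1).2).PosDef := by
    have ht : Filter.Tendsto (fun q : EuclideanSpace ℝ (Fin n) × ℝ =>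
        (jet u₁ q.1 + q.2 • jet b q.1).2) (nhds (z, 0)) (nhds (jet u₁ z).2) := by
      have h1 : ContinuousAt (fun q : EuclideanSpace ℝ (Fin n) × ℝ => jet u₁ q.1) (z, 0) :=
        ContinuousAt.comp (f := Prod.fst) (continuousAt_jet h₁) continuousAt_fst
      have h2 : ContinuousAt (fun q : EuclideanSpace ℝ (Fin n) × ℝ => jet b q.1) (z, 0) :=
        ContinuousAt.comp (f := Prod.fst) (continuousAt_jet hbC.contDiffAt) continuousAt_fst
      have := (h1.add (continuousAt_snd.smul h2)).snd
      simpa [ContinuousAt] using this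
    exact ht.eventually (eventually_posDef hpd)
  have hev := hev1.and hev2
  rw [nhds_prod_eq] at hev
  obtain ⟨pa, hpa, pb, hpb, hab⟩ := Filter.eventually_prod_iff.1 hev
  have hsmall : ∀ᶠ x in nhds z, 0 < 1 + β * s x := by
    have hc : ContinuousAt (fun x => 1 + β * s x) z :=
      (continuous_const.add (continuous_const.mul hsC.continuous)).continuousAt
    exact hc.eventually (lt_mem_nhds (by simp [hsz]))
  obtain ⟨δ, hδ, hball⟩ := Metric.eventually_nhds_iff_ball.1
    (hpa.and (hsmall.and (hle.and (hlt.and (hF₂.and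
      ((h₁.eventually (by simp)).and (h₂.eventually (by simp))))))))
  have hη : 0 < δ / 2 := half_pos hδ
  have hsub : Metric.closedBall z (δ / 2) ⊆ Metric.ball z δ :=
    Metric.closedBall_subset_ball (half_lt_self hδ)
  -- on the small sphere around `z` a small multiple of the barrier stays below `u₂ - u₁`
  have hsphere : ∀ᶠ ε in nhds (0 : ℝ), ∀ x ∈ Metric.sphere z (δ / 2),
      0 < ε → 0 < u₂ x - (u₁ x + ε * b x) := by
    refine (isCompact_sphere z (δ / 2)).eventually_forall_of_forall_eventually fun x hx => ?_
    have hxδ : x ∈ Metric.ball z δ := hsub (Metric.sphere_subset_closedBall hx)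
    obtain ⟨-, hβx, hlex, hltx, -, hc1, hc2⟩ := hball x hxδ
    have hnear : ∀ᶠ q : ℝ × EuclideanSpace ℝ (Fin n) in nhds (0, x), u₁ q.2 ≤ u₂ q.2 :=
      (continuous_snd.tendsto ((0 : ℝ), x)).eventually
        (Filter.mem_of_superset (Metric.isOpen_ball.mem_nhds hxδ) fun w hw => (hball w hw).2.2.1)
    have hbq : ContinuousAt (fun q : ℝ × EuclideanSpace ℝ (Fin n) => b q.2) (0, x) :=
      (hbC.continuous.comp continuous_snd).continuousAt
    by_cases hbx : b x < 0
    · filter_upwards [hnear, hbq.eventually (gt_mem_nhds hbx)] with q h1 h2 hq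
      nlinarith [mul_neg_of_pos_of_neg hq h2]
    · have hxz : ‖x - z‖ = δ / 2 := by simpa [dist_eq_norm] using hx
      have hspos : 0 < s x := by
        have : 0 < s x * (1 + β * s x) := by
          have h1 : b x = s x * (1 + β * s x) - ‖x - z‖ ^ 2 := by simp only [hb, ha]; ring
          have h2 : 0 < ‖x - z‖ ^ 2 := by rw [hxz]; positivity
          linarith
        exact pos_of_mul_pos_left this hβx.le
      have hd : dist x y < dist z y := by
        rw [dist_eq_norm, dist_eq_norm]
        refine lt_of_pow_lt_pow_left₀ 2 (norm_nonneg _) ?_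
        simp only [hs] at hspos
        linarith
      have hcont : ContinuousAt (fun q : ℝ × EuclideanSpace ℝ (Fin n) =>
          u₂ q.2 - (u₁ q.2 + q.1 * b q.2)) (0, x) := by
        have e1 : ContinuousAt (fun q : ℝ × EuclideanSpace ℝ (Fin n) => u₁ q.2) (0, x) :=
          ContinuousAt.comp (f := Prod.snd) hc1.continuousAt continuousAt_snd
        have e2 : ContinuousAt (fun q : ℝ × EuclideanSpace ℝ (Fin n) => u₂ q.2) (0, x) :=
          ContinuousAt.comp (f := Prod.snd) hc2.continuousAt continuousAt_snd
        exact e2.sub (e1.add (continuousAt_fst.mul hbq))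
      have := hcont.eventually (lt_mem_nhds (a := 0) (by simpa using hltx hd))
      exact this.mono fun q hq _ => hq
  obtain ⟨ε, hε, hεb, hεs⟩ : ∃ ε : ℝ, 0 < ε ∧ pb ε ∧ ∀ x ∈ Metric.sphere z (δ / 2),
      0 < ε → 0 < u₂ x - (u₁ x + ε * b x) := by
    have := (hpb.and hsphere).filter_mono (nhdsWithin_le_nhds (s := Set.Ioi 0))
    obtain ⟨ε, h1, h2⟩ := (this.and self_mem_nhdsWithin).exists
    exact ⟨ε, h2, h1⟩
  have hφC : ∀ x ∈ Metric.ball z δ, ContDiffAt ℝ 2 (fun x => u₁ x + ε * b x) x := fun x hx =>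
    (hball x hx).2.2.2.2.2.1.add (contDiffAt_const.mul hbC.contDiffAt)
  have hψC : ∀ x ∈ Metric.ball z δ,
      ContDiffAt ℝ 2 (fun x => u₂ x + -1 * (u₁ x + ε * b x)) x := fun x hx =>
    (hball x hx).2.2.2.2.2.2.add (contDiffAt_const.mul (hφC x hx))
  obtain ⟨x, hx, hmin⟩ := (isCompact_closedBall z (δ / 2)).exists_isMinOn
    ⟨z, Metric.mem_closedBall_self hη.le⟩
    (fun x hx => (hψC x (hsub hx)).continuousAt.continuousWithinAt)
  have hxs : x ∈ Metric.ball z (δ / 2) := by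
    refine Metric.mem_ball.2 (lt_of_le_of_ne (Metric.mem_closedBall.1 hx) fun h => ?_)
    have h1 := hεs x (Metric.mem_sphere.2 h) hε
    have h2 : u₂ x + -1 * (u₁ x + ε * b x) ≤ u₂ z + -1 * (u₁ z + ε * b z) :=
      hmin (Metric.mem_closedBall_self hη.le)
    rw [hbz, hz] at h2
    linarith
  have hloc : IsLocalMin (fun x => u₂ x + -1 * (u₁ x + ε * b x)) x :=
    hmin.isLocalMin (Filter.mem_of_superset (Metric.isOpen_ball.mem_nhds hxs)
      Metric.ball_subset_closedBall)
  have hxδ := hsub hx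
  obtain ⟨hpax, -, -, -, hF2x, hc1, hc2⟩ := hball x hxδ
  obtain ⟨hgrad, hhess⟩ := jet_of_isLocalMin (hψC x hxδ) hloc
  have hjφ : jet (fun x => u₁ x + ε * b x) x = jet u₁ x + ε • jet b x := by
    rw [jet_add hc1 (contDiffAt_const.mul hbC.contDiffAt), jet_const_mul hbC.contDiffAt]
  have hj : jet (fun x => u₂ x + -1 * (u₁ x + ε * b x)) x =
      jet u₂ x - (jet u₁ x + ε • jet b x) := by
    rw [jet_add hc2 (contDiffAt_const.mul (hφC x hxδ)), jet_const_mul (hφC x hxδ), hjφ,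
      neg_one_smul, sub_eq_add_neg]
  rw [hj] at hgrad hhess
  obtain ⟨hpos, hpdx⟩ := hab hpax hεb
  exact (translatorOp_pos_of_le hk (hpdx (hjφ ▸ isHermitian_jet (hφC x hxδ))) (hpos hε)
    (sub_eq_zero.1 hgrad) hhess).ne' hF2x

/-- Tangency principle (Theorem 2) for graphical `Q_k`-translators: if `u₁, u₂` are
smooth on the Euclidean ball `B_ρ(0) ⊆ ℝⁿ`, both graphs are `Q_k`-translators in the
`e_{n+1}`-direction, the graph of `u₁` is strictly convex, the principal curvatures of
the graph of `u₂` lie in `Γ_{k+1} ∩ {λ ≥ 0}`, the graphs are tangent at the interior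
point over `0`, and `u₁ ≤ u₂` (one graph lies on one side of the other), then
`u₁ = u₂` on the ball. -/
theorem tangency_principle_qk_translators
    (n k : ℕ) (hn : 2 ≤ n) (hk1 : 1 ≤ k) (hk2 : k ≤ n - 1)
    (ρ : ℝ) (hρ : 0 < ρ)
    (u₁ u₂ : EuclideanSpace ℝ (Fin n) → ℝ)
    (hsmooth₁ : ContDiffOn ℝ (⊤ : ℕ∞) u₁ (Metric.ball 0 ρ))
    (hsmooth₂ : ContDiffOn ℝ (⊤ : ℕ∞) u₂ (Metric.ball 0 ρ))
    (htrans₁ : ∀ x ∈ Metric.ball (0 : EuclideanSpace ℝ (Fin n)) ρ,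
      symFunc (weingartenMatrix u₁ x) (k + 1) * Real.sqrt (1 + gradNormSq u₁ x) =
        symFunc (weingartenMatrix u₁ x) k)
    (htrans₂ : ∀ x ∈ Metric.ball (0 : EuclideanSpace ℝ (Fin n)) ρ,
      symFunc (weingartenMatrix u₂ x) (k + 1) * Real.sqrt (1 + gradNormSq u₂ x) =
        symFunc (weingartenMatrix u₂ x) k)
    (hconvex₁ : ∀ x ∈ Metric.ball (0 : EuclideanSpace ℝ (Fin n)) ρ,
      (hessianMatrix u₁ x).PosDef)
    (hconvex₂ : ∀ x ∈ Metric.ball (0 : EuclideanSpace ℝ (Fin n)) ρ,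
      (hessianMatrix u₂ x).PosSemidef)
    (hcone₂ : ∀ x ∈ Metric.ball (0 : EuclideanSpace ℝ (Fin n)) ρ,
      ∀ l, 1 ≤ l → l ≤ k + 1 → 0 < symFunc (weingartenMatrix u₂ x) l)
    (htangent_val : u₁ 0 = u₂ 0)
    (htangent_grad : ∀ i, partialDeriv1 u₁ 0 i = partialDeriv1 u₂ 0 i)
    (hside : ∀ x ∈ Metric.ball (0 : EuclideanSpace ℝ (Fin n)) ρ, u₁ x ≤ u₂ x) :
    Set.EqOn u₁ u₂ (Metric.ball 0 ρ) := by
  have hk : k < n := by omega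
  have hopen : IsOpen (Metric.ball (0 : EuclideanSpace ℝ (Fin n)) ρ) := Metric.isOpen_ball
  have hC₁ : ∀ x ∈ Metric.ball (0 : EuclideanSpace ℝ (Fin n)) ρ, ContDiffAt ℝ 2 u₁ x :=
    fun x hx => (hsmooth₁.contDiffAt (hopen.mem_nhds hx)).of_le (WithTop.coe_le_coe.2 le_top)
  have hC₂ : ∀ x ∈ Metric.ball (0 : EuclideanSpace ℝ (Fin n)) ρ, ContDiffAt ℝ 2 u₂ x :=
    fun x hx => (hsmooth₂.contDiffAt (hopen.mem_nhds hx)).of_le (WithTop.coe_le_coe.2 le_top)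
  set U := {x ∈ Metric.ball (0 : EuclideanSpace ℝ (Fin n)) ρ | u₁ x < u₂ x} with hU
  have hUopen : IsOpen U := by
    rw [isOpen_iff_mem_nhds]
    rintro x ⟨hx, hlt⟩
    exact (hopen.mem_nhds hx |> Filter.inter_mem <|
      (hC₁ x hx).continuousAt.eventually_lt (hC₂ x hx).continuousAt hlt)
  by_contra hne
  have hUne : (Metric.ball (0 : EuclideanSpace ℝ (Fin n)) ρ ∩ U).Nonempty := by
    simp only [Set.EqOn, not_forall] at hne
    obtain ⟨x, hx, hxne⟩ := hne
    exact ⟨x, hx, hx, lt_of_le_of_ne (hside x hx) hxne⟩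
  have h0 : (0 : EuclideanSpace ℝ (Fin n)) ∈ Metric.ball 0 ρ := Metric.mem_ball_self hρ
  suffices hcl : closure U ∩ Metric.ball 0 ρ ⊆ U from
    ((convex_ball _ ρ).isPreconnected.subset_of_closure_inter_subset hUopen hUne hcl h0).2.ne
      htangent_val
  rintro z₀ ⟨hz₀cl, hz₀⟩
  refine ⟨hz₀, lt_of_le_of_ne (hside z₀ hz₀) fun heq => ?_⟩
  obtain ⟨R, hR, hRsub⟩ := Metric.nhds_basis_closedBall.mem_iff.1 (hopen.mem_nhds hz₀)
  obtain ⟨a, ⟨ha, halt⟩, had⟩ := Metric.mem_closure_iff.1 hz₀cl (R / 2) (half_pos hR)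
  have hKcpt : IsCompact {x ∈ Metric.closedBall z₀ R | u₁ x = u₂ x} := by
    refine (isCompact_closedBall z₀ R).of_isClosed_subset ?_ (Set.sep_subset _ _)
    have hc : ContinuousOn (fun x => u₁ x - u₂ x) (Metric.closedBall z₀ R) := fun x hx =>
      ((hC₁ x (hRsub hx)).continuousAt.sub (hC₂ x (hRsub hx)).continuousAt).continuousWithinAt
    have := hc.preimage_isClosed_of_isClosed Metric.isClosed_closedBall (isClosed_singleton (x := 0))
    exact (Set.ext fun x => and_congr_right fun _ => sub_eq_zero.symm :
      {x ∈ Metric.closedBall z₀ R | u₁ x = u₂ x} =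
        Metric.closedBall z₀ R ∩ (fun x => u₁ x - u₂ x) ⁻¹' {0}) ▸ this
  have hz₀K : z₀ ∈ {x ∈ Metric.closedBall z₀ R | u₁ x = u₂ x} :=
    ⟨Metric.mem_closedBall_self hR.le, heq⟩
  obtain ⟨z, ⟨hzR, hzeq⟩, hmin⟩ := hKcpt.exists_isMinOn ⟨z₀, hz₀K⟩
    (continuous_id.dist (continuous_const (y := a))).continuousOn
  have hza : dist z a ≤ dist z₀ a := hmin hz₀K
  have hzball := hRsub hzR
  have hnear := hopen.mem_nhds hzball
  refine translator_not_touching hk (y := a) (hC₁ z hzball) (hC₂ z hzball)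
    (Filter.mem_of_superset hnear fun x hx => ?_) (Filter.mem_of_superset hnear fun x hx => ?_)
    (hconvex₁ z hzball) (Filter.mem_of_superset hnear hside) hzeq ?_
    (Filter.mem_of_superset hnear fun x hx hxa => ?_)
  · exact (translatorOp_jet u₁ x).trans (sub_eq_zero.2 (htrans₁ x hx))
  · exact (translatorOp_jet u₂ x).trans (sub_eq_zero.2 (htrans₂ x hx))
  · rintro rfl
    exact halt.ne hzeq
  · refine lt_of_le_of_ne (hside x hx) fun hxeq => ?_
    have hxR : x ∈ Metric.closedBall z₀ R := by
      have := dist_triangle_right x z₀ a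
      rw [Metric.mem_closedBall]
      linarith
    exact hxa.not_ge (hmin ⟨hxR, hxeq⟩)
end
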